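/- arXiv:1201.4871 — 4 statements merged into one kernel-verified Lean document; each statement's English description precedes it below -/
import Mathlib

section
/- For every synchronous QDAS A (with set of states S, variables X over finite domain D), where without loss of generality a synchronous dispatch and the scheduler step that dequeues the dispatched block are combined into a single atomic transition, one can construct a pushdown system with data P_A with stack alphabet S and the same variables X over D such that: for every finite run c0 a1 c1 ... an cn of A there exists a run x0 a1 x1 ... an xn of P_A such that, writing c_i = (G_i, d_i) and x_i = (s_i, w_i, d'_i), one has d_i = d'_i and G_i is encoded by the word w_i * s_i for all 0 <= i <= n; and conversely, for every run of P_A there exists a run of A related in the same way. Here a CTG G is encoded by a word u = u_0 u_1 ... u_n over S iff G consists of vertices v_0, ..., v_n forming a single path of wait edges with state(v_i) = u_i for all i, and the empty CTG is encoded by the empty word. -/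
open scoped Classical

/-! ### Generic labeled runs -/

/-- A run `c0 = cs 0, ls 0, cs 1, ls 1, …, cs n` of a labeled transition relation. -/
def IsRun {C L : Type} (step : C → L → C → Prop) (c0 : C) (n : ℕ)
    (cs : ℕ → C) (ls : ℕ → L) : Prop :=
  cs 0 = c0 ∧ ∀ i < n, step (cs i) (ls i) (cs (i + 1))

/-! ### Guards over variables `X` ranging over a finite domain `D`.
A guard is a finite conjunction of atoms `x = d` (flag `true`) and `x ≠ d` (flag `false`). -/

def GuardSat {X D : Type} (d : X → D) (g : List (X × D × Bool)) : Prop :=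
  ∀ a ∈ g, if a.2.2 then d a.1 = a.2.1 else d a.1 ≠ a.2.1

/-! ### QDAS actions -/

inductive QAct (Q Γ X D : Type) : Type
  | dispatchA (q : Q) (γ : Γ)
  | dispatchS (q : Q) (γ : Γ)
  | guard (g : List (X × D × Bool))
  | assign (x : X) (d : D)

/-! ### Call-task graphs -/

/-- A call-task graph over queue identifiers `Q`, blocks `Γ` and states `S`.
Vertices are natural numbers; the graph consists of the finite set `verts`.
`task v` tells whether `v` is a task vertex (otherwise it is a call vertex),
`qEdge`/`wEdge` are the queue resp. wait edges, `lab` is the labeling by blocks,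
`queueOf v = some q` records the queue of `v` (`none` is the dummy symbol ι),
and `st` is the labeling by states. -/
structure CTG (Q Γ S : Type) : Type where
  verts : Finset ℕ
  task : ℕ → Prop
  qEdge : ℕ → ℕ → Prop
  wEdge : ℕ → ℕ → Prop
  lab : ℕ → Γ
  queueOf : ℕ → Option Q
  st : ℕ → S

namespace CTG

variable {Q Γ S : Type}

def edge (G : CTG Q Γ S) (a b : ℕ) : Prop := G.qEdge a b ∨ G.wEdge a b

/-- A vertex is unblocked iff it is in the graph and has no outgoing edge. -/
def Unblocked (G : CTG Q Γ S) (v : ℕ) : Prop := v ∈ G.verts ∧ ∀ b, ¬ G.edge v b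

/-- The most recently enqueued call vertex of `q`: a call vertex of `q`
with no incoming queue edge. -/
def IsTail (G : CTG Q Γ S) (q : Q) (b : ℕ) : Prop :=
  b ∈ G.verts ∧ ¬ G.task b ∧ G.queueOf b = some q ∧ ∀ a, ¬ G.qEdge a b

/-- The head of `q`: a call vertex of `q` with no outgoing queue edge. -/
def IsHead (G : CTG Q Γ S) (q : Q) (v : ℕ) : Prop :=
  v ∈ G.verts ∧ ¬ G.task v ∧ G.queueOf v = some q ∧ ∀ b, ¬ G.qEdge v b

/-- Update the state of vertex `v` to `s`. -/
def setSt (G : CTG Q Γ S) (v : ℕ) (s : S) : CTG Q Γ S :=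
  { G with st := Function.update G.st v s }

/-- Add a wait edge from `a` to `b`. -/
def addWait (G : CTG Q Γ S) (a b : ℕ) : CTG Q Γ S :=
  { G with wEdge := fun x y => G.wEdge x y ∨ (x = a ∧ y = b) }

/-- Enqueue a fresh call vertex `v'` for block `γ` (with initial state `s0`) into
queue `q`: a queue edge from `v'` to the most recently enqueued call vertex of `q`
(if any) is added, and, if `q` is serial and a task vertex of `q` is present,
a wait edge from `v'` to it. -/
def enqueue (G : CTG Q Γ S) (serialq : Prop) (q : Q) (γ : Γ) (s0 : S) (v' : ℕ) :
    CTG Q Γ S where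
  verts := insert v' G.verts
  task := fun u => u ≠ v' ∧ G.task u
  qEdge := fun a b => G.qEdge a b ∨ (a = v' ∧ G.IsTail q b)
  wEdge := fun a b =>
    G.wEdge a b ∨ (serialq ∧ a = v' ∧ b ∈ G.verts ∧ G.task b ∧ G.queueOf b = some q)
  lab := Function.update G.lab v' γ
  queueOf := Function.update G.queueOf v' (some q)
  st := Function.update G.st v' s0

/-- Dequeue the head `v` of its queue: `v` becomes a task vertex, its incident
queue edges disappear, and if the queue is serial a wait edge is added from the new
head of the queue (the call vertex with a queue edge to `v`, if any) to `v`. -/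
def dequeue (G : CTG Q Γ S) (serialq : Prop) (v : ℕ) : CTG Q Γ S :=
  { G with
    task := fun u => u = v ∨ G.task u
    qEdge := fun a b => G.qEdge a b ∧ a ≠ v ∧ b ≠ v
    wEdge := fun a b => G.wEdge a b ∨ (serialq ∧ b = v ∧ G.qEdge a v) }

/-- Remove vertex `v` together with its incident edges. -/
def erase (G : CTG Q Γ S) (v : ℕ) : CTG Q Γ S :=
  { G with
    verts := G.verts.erase v
    qEdge := fun a b => G.qEdge a b ∧ a ≠ v ∧ b ≠ v
    wEdge := fun a b => G.wEdge a b ∧ a ≠ v ∧ b ≠ v }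

/-- The Parikh image of a CTG: the number of vertices in state `s`. -/
noncomputable def parikh (G : CTG Q Γ S) (s : S) : ℕ :=
  (G.verts.filter fun v => G.st v = s).card

/-- `G` is encoded by the word `u = u₀u₁⋯uₙ` over `S` iff `G` consists of vertices
`v₀,…,vₙ` forming a single path of wait edges with `st vᵢ = uᵢ` (and no queue edges);
the empty CTG is encoded by the empty word. -/
def EncodedBy (G : CTG Q Γ S) (u : List S) : Prop :=
  ∃ vs : List ℕ, vs.Nodup ∧ vs.toFinset = G.verts ∧ vs.map G.st = u ∧
    (∀ a b, G.wEdge a b ↔ (a, b) ∈ vs.zip vs.tail) ∧ ∀ a b, ¬ G.qEdge a b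

end CTG

/-! ### Queue-dispatch asynchronous systems -/

/-- A QDAS over queue ids `Q` (serial ones are those satisfying `serial`),
blocks `Γ` with initial block `main`, variables `X` over domain `D` with initial
value `d0`, and states `S`, partitioned among the blocks by `blockOf`, each block
`γ` having initial state `init γ` and final state `final γ`. -/
structure QDAS (Q Γ X D S : Type) : Type where
  serial : Q → Prop
  main : Γ
  d0 : D
  blockOf : S → Γ
  init : Γ → S
  final : Γ → S
  init_block : ∀ γ, blockOf (init γ) = γ
  final_block : ∀ γ, blockOf (final γ) = γ
  rules : Set (S × QAct Q Γ X D × S)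
  rules_fin : rules.Finite
  rules_block : ∀ r ∈ rules, blockOf r.1 = blockOf r.2.2
  rules_not_main : ∀ r ∈ rules, ∀ q γ,
    (r.2.1 = QAct.dispatchA q γ ∨ r.2.1 = QAct.dispatchS q γ) → γ ≠ main

/-- A configuration of a QDAS: a call-task graph together with a valuation. -/
abbrev QConfig (Q Γ X D S : Type) : Type := CTG Q Γ S × (X → D)

namespace QDAS

variable {Q Γ X D S : Type}

/-- The initial CTG: a single task vertex running `main`. -/
def initCTG (A : QDAS Q Γ X D S) : CTG Q Γ S where
  verts := {0}
  task := fun v => v = 0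
  qEdge := fun _ _ => False
  wEdge := fun _ _ => False
  lab := fun _ => A.main
  queueOf := fun _ => none
  st := fun _ => A.init A.main

def initConfig (A : QDAS Q Γ X D S) : QConfig Q Γ X D S := (A.initCTG, fun _ => A.d0)

/-- The labeled transition relation of a QDAS (`none` is the scheduler label ε). -/
inductive Step (A : QDAS Q Γ X D S) :
    QConfig Q Γ X D S → Option (QAct Q Γ X D) → QConfig Q Γ X D S → Prop
  | guard {G : CTG Q Γ S} {d : X → D} {v : ℕ} {g : List (X × D × Bool)} {s' : S} :
      G.task v → G.Unblocked v → (G.st v, QAct.guard g, s') ∈ A.rules → GuardSat d g →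
      Step A (G, d) (some (QAct.guard g)) (G.setSt v s', d)
  | assign {G : CTG Q Γ S} {d : X → D} {v : ℕ} {x : X} {dd : D} {s' : S} :
      G.task v → G.Unblocked v → (G.st v, QAct.assign x dd, s') ∈ A.rules →
      Step A (G, d) (some (QAct.assign x dd)) (G.setSt v s', Function.update d x dd)
  | dispatchA {G : CTG Q Γ S} {d : X → D} {v : ℕ} {q : Q} {γ : Γ} {s' : S} {v' : ℕ} :
      G.task v → G.Unblocked v → (G.st v, QAct.dispatchA q γ, s') ∈ A.rules →
      v' ∉ G.verts →
      Step A (G, d) (some (QAct.dispatchA q γ))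
        ((G.setSt v s').enqueue (A.serial q) q γ (A.init γ) v', d)
  | dispatchS {G : CTG Q Γ S} {d : X → D} {v : ℕ} {q : Q} {γ : Γ} {s' : S} {v' : ℕ} :
      G.task v → G.Unblocked v → (G.st v, QAct.dispatchS q γ, s') ∈ A.rules →
      v' ∉ G.verts →
      Step A (G, d) (some (QAct.dispatchS q γ))
        (((G.setSt v s').enqueue (A.serial q) q γ (A.init γ) v').addWait v v', d)
  | schedErase {G : CTG Q Γ S} {d : X → D} {v : ℕ} :
      G.task v → G.Unblocked v → G.st v = A.final (G.lab v) →
      Step A (G, d) none (G.erase v, d)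
  | schedDequeue {G : CTG Q Γ S} {d : X → D} {q : Q} {v : ℕ} :
      G.IsHead q v → (∀ b, ¬ G.edge v b) →
      Step A (G, d) none (G.dequeue (A.serial q) v, d)

/-- Reachable configurations. -/
def Reach (A : QDAS Q Γ X D S) : Set (QConfig Q Γ X D S) :=
  { c | Relation.ReflTransGen (fun c1 c2 => ∃ a, A.Step c1 a c2) A.initConfig c }

/-- `f` is Parikh-coverable in `A` iff some reachable configuration covers it. -/
def ParikhCoverable (A : QDAS Q Γ X D S) (f : S → ℕ) : Prop :=
  ∃ c ∈ A.Reach, ∀ s, f s ≤ c.1.parikh s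

/-- A QDAS is synchronous iff no rule carries an asynchronous dispatch. -/
def Synchronous (A : QDAS Q Γ X D S) : Prop :=
  ∀ r ∈ A.rules, ∀ q γ, r.2.1 ≠ QAct.dispatchA q γ

/-- A QDAS is asynchronous iff no rule carries a synchronous dispatch. -/
def Asynchronous (A : QDAS Q Γ X D S) : Prop :=
  ∀ r ∈ A.rules, ∀ q γ, r.2.1 ≠ QAct.dispatchS q γ

/-- A QDAS terminates iff it admits no infinite run. -/
def Terminates (A : QDAS Q Γ X D S) : Prop :=
  ¬ ∃ cs : ℕ → QConfig Q Γ X D S,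
      cs 0 = A.initConfig ∧ ∀ i, ∃ a, A.Step (cs i) a (cs (i + 1))

end QDAS

/-! ### Pushdown systems (without data) -/

inductive PAct (Φ : Type) : Type
  | push (φ : Φ)
  | pop (φ : Φ)
  | internal (n : ℕ)

structure PDS (Y Φ : Type) : Type where
  y0 : Y
  rules : Set (Y × PAct Φ × Y)
  rules_fin : rules.Finite

namespace PDS

variable {Y Φ : Type}

inductive Step (P : PDS Y Φ) : Y × List Φ → PAct Φ → Y × List Φ → Prop
  | push {y y' : Y} {φ : Φ} {w : List Φ} :
      (y, PAct.push φ, y') ∈ P.rules → Step P (y, w) (PAct.push φ) (y', w ++ [φ])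
  | pop {y y' : Y} {φ : Φ} {w : List Φ} :
      (y, PAct.pop φ, y') ∈ P.rules → Step P (y, w ++ [φ]) (PAct.pop φ) (y', w)
  | internal {y y' : Y} {n : ℕ} {w : List Φ} :
      (y, PAct.internal n, y') ∈ P.rules → Step P (y, w) (PAct.internal n) (y', w)

def initConfig (P : PDS Y Φ) : Y × List Φ := (P.y0, [])

def Reachable (P : PDS Y Φ) (c : Y × List Φ) : Prop :=
  Relation.ReflTransGen (fun a b => ∃ l, P.Step a l b) P.initConfig c

end PDS

/-! ### Pushdown systems with data -/

inductive PDAct (Φ X D : Type) : Type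
  | push (φ : Φ)
  | pop (φ : Φ)
  | guard (g : List (X × D × Bool))
  | assign (x : X) (d : D)
  | internal (n : ℕ)

structure PDSD (Y Φ X D : Type) : Type where
  y0 : Y
  d0 : D
  rules : Set (Y × PDAct Φ X D × Y)
  rules_fin : rules.Finite

namespace PDSD

variable {Y Φ X D : Type}

inductive Step (P : PDSD Y Φ X D) :
    Y × List Φ × (X → D) → PDAct Φ X D → Y × List Φ × (X → D) → Prop
  | push {y y' : Y} {φ : Φ} {w : List Φ} {d : X → D} :
      (y, PDAct.push φ, y') ∈ P.rules →
      Step P (y, w, d) (PDAct.push φ) (y', w ++ [φ], d)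
  | pop {y y' : Y} {φ : Φ} {w : List Φ} {d : X → D} :
      (y, PDAct.pop φ, y') ∈ P.rules →
      Step P (y, w ++ [φ], d) (PDAct.pop φ) (y', w, d)
  | guard {y y' : Y} {g : List (X × D × Bool)} {w : List Φ} {d : X → D} :
      (y, PDAct.guard g, y') ∈ P.rules → GuardSat d g →
      Step P (y, w, d) (PDAct.guard g) (y', w, d)
  | assign {y y' : Y} {x : X} {dd : D} {w : List Φ} {d : X → D} :
      (y, PDAct.assign x dd, y') ∈ P.rules →
      Step P (y, w, d) (PDAct.assign x dd) (y', w, Function.update d x dd)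
  | internal {y y' : Y} {n : ℕ} {w : List Φ} {d : X → D} :
      (y, PDAct.internal n, y') ∈ P.rules →
      Step P (y, w, d) (PDAct.internal n) (y', w, d)

def initConfig (P : PDSD Y Φ X D) : Y × List Φ × (X → D) := (P.y0, [], fun _ => P.d0)

def Reachable (P : PDSD Y Φ X D) (c : Y × List Φ × (X → D)) : Prop :=
  Relation.ReflTransGen (fun a b => ∃ l, P.Step a l b) P.initConfig c

end PDSD

/-! ### Petri nets -/

/-- A Petri net over places `P`: transitions are pairs of `{0,1}`-valued input and
output functions (represented as `P → Bool`). -/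
structure PetriNet (P : Type) : Type where
  trans : Set ((P → Bool) × (P → Bool))
  trans_fin : trans.Finite
  m0 : P → ℕ

namespace PetriNet

variable {P : Type}

def inp (t : (P → Bool) × (P → Bool)) (p : P) : ℕ := if t.1 p then 1 else 0
def out (t : (P → Bool) × (P → Bool)) (p : P) : ℕ := if t.2 p then 1 else 0

def FiresVia (N : PetriNet P) (t : (P → Bool) × (P → Bool)) (m m' : P → ℕ) : Prop :=
  t ∈ N.trans ∧ (∀ p, inp t p ≤ m p) ∧ ∀ p, m' p = m p - inp t p + out t p

def Fires (N : PetriNet P) (m m' : P → ℕ) : Prop := ∃ t, N.FiresVia t m m'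

def Reach (N : PetriNet P) : Set (P → ℕ) :=
  { m | Relation.ReflTransGen N.Fires N.m0 m }

def Cover (N : PetriNet P) : Set (P → ℕ) := { m | ∃ m' ∈ N.Reach, m ≤ m' }

/-- A Petri net terminates iff it admits no infinite run. -/
def Terminates (N : PetriNet P) : Prop :=
  ¬ ∃ ms : ℕ → (P → ℕ), ms 0 = N.m0 ∧ ∀ i, N.Fires (ms i) (ms (i + 1))

end PetriNet

/-! ### Synchronous QDAS with atomic synchronous dispatch (Proposition: sync QDAS ≙ PDS with data) -/

/-- Add a fresh vertex `v'` directly as a *task* vertex of queue `q`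
(used for the atomic combination of a synchronous dispatch with the scheduler
step dequeueing the dispatched block). -/
def CTG.addTask {Q Γ S : Type} (G : CTG Q Γ S) (q : Q) (γ : Γ) (s0 : S) (v' : ℕ) :
    CTG Q Γ S where
  verts := insert v' G.verts
  task := fun u => u = v' ∨ G.task u
  qEdge := G.qEdge
  wEdge := G.wEdge
  lab := Function.update G.lab v' γ
  queueOf := Function.update G.queueOf v' (some q)
  st := Function.update G.st v' s0

/-- The transition relation of a QDAS in which a synchronous dispatch and the
scheduler step that dequeues the dispatched block are combined into a single
atomic transition: the dispatched block immediately becomes a running task,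
with a wait edge from the dispatcher to it.  All other transitions are as usual. -/
inductive QDAS.StepAtomic {Q Γ X D S : Type} (A : QDAS Q Γ X D S) :
    QConfig Q Γ X D S → Option (QAct Q Γ X D) → QConfig Q Γ X D S → Prop
  | guard {G : CTG Q Γ S} {d : X → D} {v : ℕ} {g : List (X × D × Bool)} {s' : S} :
      G.task v → G.Unblocked v → (G.st v, QAct.guard g, s') ∈ A.rules → GuardSat d g →
      StepAtomic A (G, d) (some (QAct.guard g)) (G.setSt v s', d)
  | assign {G : CTG Q Γ S} {d : X → D} {v : ℕ} {x : X} {dd : D} {s' : S} :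
      G.task v → G.Unblocked v → (G.st v, QAct.assign x dd, s') ∈ A.rules →
      StepAtomic A (G, d) (some (QAct.assign x dd)) (G.setSt v s', Function.update d x dd)
  | dispatchA {G : CTG Q Γ S} {d : X → D} {v : ℕ} {q : Q} {γ : Γ} {s' : S} {v' : ℕ} :
      G.task v → G.Unblocked v → (G.st v, QAct.dispatchA q γ, s') ∈ A.rules →
      v' ∉ G.verts →
      StepAtomic A (G, d) (some (QAct.dispatchA q γ))
        ((G.setSt v s').enqueue (A.serial q) q γ (A.init γ) v', d)
  | dispatchS {G : CTG Q Γ S} {d : X → D} {v : ℕ} {q : Q} {γ : Γ} {s' : S} {v' : ℕ} :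
      G.task v → G.Unblocked v → (G.st v, QAct.dispatchS q γ, s') ∈ A.rules →
      v' ∉ G.verts →
      StepAtomic A (G, d) (some (QAct.dispatchS q γ))
        (((G.setSt v s').addTask q γ (A.init γ) v').addWait v v', d)
  | schedErase {G : CTG Q Γ S} {d : X → D} {v : ℕ} :
      G.task v → G.Unblocked v → G.st v = A.final (G.lab v) →
      StepAtomic A (G, d) none (G.erase v, d)
  | schedDequeue {G : CTG Q Γ S} {d : X → D} {q : Q} {v : ℕ} :
      G.IsHead q v → (∀ b, ¬ G.edge v b) →
      StepAtomic A (G, d) none (G.dequeue (A.serial q) v, d)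

/-! ### Helper facts for the equivalence -/

/-- A forward simulation between labeled transition relations lifts to runs. -/
theorem IsRun.simulate {C L C' L' : Type} {step : C → L → C → Prop}
    {step' : C' → L' → C' → Prop} {R : C → C' → Prop} {c0 : C} {x0 : C'}
    (hl : Nonempty L') (h0 : R c0 x0)
    (hstep : ∀ c l c' x, R c x → step c l c' → ∃ l' x', step' x l' x' ∧ R c' x')
    (n : ℕ) (cs : ℕ → C) (ls : ℕ → L) (hrun : IsRun step c0 n cs ls) :
    ∃ (xs : ℕ → C') (ls' : ℕ → L'), IsRun step' x0 n xs ls' ∧ ∀ i ≤ n, R (cs i) (xs i) := by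
  obtain ⟨hcs, hs⟩ := hrun
  induction n with
  | zero =>
    refine ⟨fun _ => x0, fun _ => hl.some, ⟨rfl, by simp⟩, fun i hi => ?_⟩
    obtain rfl : i = 0 := by omega
    rwa [hcs]
  | succ n ih =>
    obtain ⟨xs, ls', ⟨hx0, hxs⟩, hR⟩ := ih fun i hi => hs i (by omega)
    obtain ⟨l', x', hst, hR'⟩ := hstep _ _ _ _ (hR n le_rfl) (hs n (by omega))
    refine ⟨Function.update xs (n + 1) x', Function.update ls' n l', ⟨?_, fun i hi => ?_⟩,
      fun i hi => ?_⟩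
    · rwa [Function.update_of_ne (by omega)]
    · rw [Function.update_of_ne (show i ≠ n + 1 by omega)]
      rcases Nat.lt_succ_iff_lt_or_eq.mp hi with hi | rfl
      · rw [Function.update_of_ne (by omega), Function.update_of_ne (by omega)]
        exact hxs i hi
      · simpa using hst
    · rcases Nat.le_succ_iff.mp hi with hi | rfl
      · rw [Function.update_of_ne (by omega)]
        exact hR i hi
      · simpa using hR'

theorem List.mem_zip_tail_append_pair {α : Type} (us : List α) (v v' a b : α) :
    (a, b) ∈ (us ++ [v] ++ [v']).zip (us ++ [v] ++ [v']).tail ↔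
      (a, b) ∈ (us ++ [v]).zip (us ++ [v]).tail ∨ (a = v ∧ b = v') := by
  induction us with
  | nil => simp
  | cons x us ih =>
    cases us with
    | nil => simp
    | cons y us => simp at ih ⊢; tauto

theorem List.Nodup.notMem_zip_tail_last {α : Type} {us : List α} {v : α}
    (h : (us ++ [v]).Nodup) (b : α) : (v, b) ∉ (us ++ [v]).zip (us ++ [v]).tail := by
  induction us with
  | nil => simp
  | cons x us ih =>
    have hx : v ≠ x := by rintro rfl; simp at h
    have ih := ih (List.nodup_cons.mp h).2
    cases us with
    | nil => simp [hx]
    | cons y us => simpa [hx] using ih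

theorem List.eq_append_of_notMem_zip_tail {α : Type} {vs : List α} {v : α} (hv : v ∈ vs)
    (h : ∀ b, (v, b) ∉ vs.zip vs.tail) : ∃ us, vs = us ++ [v] := by
  induction vs with
  | nil => simp at hv
  | cons x vs ih =>
    cases vs with
    | nil => exact ⟨[], by rw [List.mem_singleton.mp hv, List.nil_append]⟩
    | cons y vs =>
      have hx : v ≠ x := by rintro rfl; exact h y (by simp)
      obtain ⟨us, hus⟩ := ih ((List.mem_cons.mp hv).resolve_left hx) fun b hb =>
        h b (List.mem_cons_of_mem _ hb)
      exact ⟨x :: us, by rw [hus, List.cons_append]⟩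

/-- `G` is a single path of wait edges through the task vertices `vs`, whose labels agree
with the blocks of their states. -/
structure CTG.IsTaskPath {Q Γ X D S : Type} (A : QDAS Q Γ X D S) (G : CTG Q Γ S)
    (vs : List ℕ) : Prop where
  nodup : vs.Nodup
  verts_eq : vs.toFinset = G.verts
  wEdge_iff : ∀ a b, G.wEdge a b ↔ (a, b) ∈ vs.zip vs.tail
  not_qEdge : ∀ a b, ¬ G.qEdge a b
  task : ∀ v ∈ vs, G.task v
  lab_eq : ∀ v ∈ vs, G.lab v = A.blockOf (G.st v)

namespace CTG.IsTaskPath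

variable {Q Γ X D S : Type} {A : QDAS Q Γ X D S} {G : CTG Q Γ S} {vs us : List ℕ} {v v' : ℕ}

theorem mem_verts (h : IsTaskPath A G vs) : v ∈ G.verts ↔ v ∈ vs := by
  rw [← h.verts_eq, List.mem_toFinset]

theorem encodedBy (h : IsTaskPath A G vs) : G.EncodedBy (vs.map G.st) :=
  ⟨vs, h.nodup, h.verts_eq, rfl, h.wEdge_iff, h.not_qEdge⟩

theorem eq_append_of_unblocked (h : IsTaskPath A G vs) (hv : G.Unblocked v) :
    ∃ us, vs = us ++ [v] :=
  List.eq_append_of_notMem_zip_tail (h.mem_verts.mp hv.1) fun b hb =>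
    hv.2 b (Or.inr ((h.wEdge_iff v b).mpr hb))

theorem unblocked_last (h : IsTaskPath A G (us ++ [v])) : G.Unblocked v := by
  refine ⟨h.mem_verts.mpr (by simp), fun b hb => ?_⟩
  rcases hb with hb | hb
  · exact h.not_qEdge _ _ hb
  · exact h.nodup.notMem_zip_tail_last b ((h.wEdge_iff v b).mp hb)

theorem not_isHead (h : IsTaskPath A G vs) (q : Q) : ¬ G.IsHead q v :=
  fun hv => hv.2.1 (h.task v (h.mem_verts.mp hv.1))

theorem notMem_init (h : IsTaskPath A G (us ++ [v])) : v ∉ us := fun hv =>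
  List.disjoint_of_nodup_append h.nodup hv (by simp)

theorem setSt (h : IsTaskPath A G vs) {s' : S} (hs : A.blockOf (G.st v) = A.blockOf s') :
    IsTaskPath A (G.setSt v s') vs where
  nodup := h.nodup
  verts_eq := h.verts_eq
  wEdge_iff := h.wEdge_iff
  not_qEdge := h.not_qEdge
  task := h.task
  lab_eq u hu := by
    have hl := h.lab_eq u hu
    by_cases huv : u = v
    · subst huv; simpa [CTG.setSt, hs] using hl
    · simpa [CTG.setSt, huv] using hl

theorem map_setSt (h : IsTaskPath A G (us ++ [v])) (s' : S) :
    (us ++ [v]).map (G.setSt v s').st = us.map G.st ++ [s'] := by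
  have hu : us.map (Function.update G.st v s') = us.map G.st :=
    List.map_congr_left fun u hu =>
      Function.update_of_ne (fun e => h.notMem_init (by rwa [← e])) _ _
  simp [CTG.setSt, hu]

theorem addTask (h : IsTaskPath A G (us ++ [v])) (hv' : v' ∉ G.verts) (q : Q) (γ : Γ) :
    IsTaskPath A ((G.addTask q γ (A.init γ) v').addWait v v') (us ++ [v] ++ [v']) where
  nodup := by
    have := mt h.mem_verts.mpr hv'
    exact List.Nodup.append h.nodup (by simp) (by simpa using this)
  verts_eq := by
    ext u
    simp [CTG.addTask, CTG.addWait, h.mem_verts]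
    tauto
  wEdge_iff a b := by
    rw [List.mem_zip_tail_append_pair, ← h.wEdge_iff]
    rfl
  not_qEdge := h.not_qEdge
  task u hu := by
    rcases List.mem_append.mp hu with hu | hu
    · exact Or.inr (h.task u hu)
    · exact Or.inl (by simpa using hu)
  lab_eq u hu := by
    by_cases huv : u = v'
    · simp [CTG.addTask, CTG.addWait, huv, A.init_block]
    · have hu' : u ∈ us ++ [v] := (List.mem_append.mp hu).resolve_right (by simpa using huv)
      simpa [CTG.addTask, CTG.addWait, huv] using h.lab_eq u hu'

theorem map_addTask (h : IsTaskPath A G vs) (hv' : v' ∉ G.verts) (q : Q) (γ : Γ) (s0 : S) :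
    (vs ++ [v']).map ((G.addTask q γ s0 v').addWait v v').st = vs.map G.st ++ [s0] := by
  have hu : vs.map (Function.update G.st v' s0) = vs.map G.st :=
    List.map_congr_left fun u hu =>
      Function.update_of_ne (fun e => hv' (h.mem_verts.mpr (by rwa [← e]))) _ _
  simp [CTG.addTask, CTG.addWait, hu]

theorem erase (h : IsTaskPath A G (us ++ [v])) : IsTaskPath A (G.erase v) us where
  nodup := (List.nodup_append.mp h.nodup).1
  verts_eq := by
    have hv := h.notMem_init
    ext u
    simp only [CTG.erase, Finset.mem_erase, h.mem_verts, List.mem_toFinset, List.mem_append,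
      List.mem_singleton]
    constructor
    · exact fun hu => ⟨fun e => hv (by rwa [← e]), Or.inl hu⟩
    · exact fun hu => hu.2.resolve_right hu.1
  wEdge_iff a b := by
    have hv := h.notMem_init
    have hw := h.wEdge_iff a b
    simp only [CTG.erase, hw]
    rcases List.eq_nil_or_concat us with rfl | ⟨ps, t, rfl⟩
    · simp
    · simp only [List.concat_eq_append] at hv ⊢
      rw [List.mem_zip_tail_append_pair]
      constructor
      · rintro ⟨hab | hab, -, hb⟩
        · exact hab
        · exact absurd hab.2 hb
      · intro hab
        have hm := List.of_mem_zip hab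
        refine ⟨Or.inl hab, fun e => hv (e ▸ hm.1), fun e => hv (e ▸ List.mem_of_mem_tail hm.2)⟩
  not_qEdge a b hab := h.not_qEdge a b hab.1
  task u hu := h.task u (List.mem_append_left _ hu)
  lab_eq u hu := h.lab_eq u (List.mem_append_left _ hu)

end CTG.IsTaskPath

namespace QDAS

variable {Q Γ X D S : Type}

theorem initCTG_isTaskPath (A : QDAS Q Γ X D S) : A.initCTG.IsTaskPath A [0] where
  nodup := by simp
  verts_eq := rfl
  wEdge_iff := by simp [initCTG]
  not_qEdge := by simp [initCTG]
  task := by simp [initCTG]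
  lab_eq := by simp [initCTG, A.init_block]

/-- The pushdown rule simulating a rule of a synchronous QDAS at the top of the stack. -/
def toPDSDRule (A : QDAS Q Γ X D S) :
    S × QAct Q Γ X D × S → Option S × PDAct S X D × Option S
  | (s, QAct.guard g, s') => (some s, PDAct.guard g, some s')
  | (s, QAct.assign x d, s') => (some s, PDAct.assign x d, some s')
  | (s, QAct.dispatchS _ γ, s') => (some s, PDAct.push s', some (A.init γ))
  | (s, QAct.dispatchA _ γ, s') => (some s, PDAct.push s', some (A.init γ))

/-- The pushdown system with data simulating a synchronous QDAS. The control state holds the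
state of the only unblocked task; a terminated task is removed either by popping its
dispatcher into the control state or by moving to the control state `none`, which is a
deadlock. -/
def toPDSD [Finite S] (A : QDAS Q Γ X D S) : PDSD (Option S) S X D where
  y0 := some (A.init A.main)
  d0 := A.d0
  rules := A.toPDSDRule '' A.rules ∪
    (fun p : S × Option S => (some p.1, p.2.elim (PDAct.internal 0) PDAct.pop, p.2)) ''
      {p | p.1 = A.final (A.blockOf p.1)}
  rules_fin := (A.rules_fin.image _).union ((Set.toFinite _).image _)

/-- The configuration `c` of a QDAS is represented by the pushdown configuration `x`. -/
def Represents (A : QDAS Q Γ X D S) (c : QConfig Q Γ X D S)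
    (x : Option S × List S × (X → D)) : Prop :=
  c.2 = x.2.2 ∧ ∃ vs, c.1.IsTaskPath A vs ∧ vs.map c.1.st = x.2.1 ++ x.1.toList

theorem Represents.encodedBy {A : QDAS Q Γ X D S} {c : QConfig Q Γ X D S}
    {x : Option S × List S × (X → D)} (h : A.Represents c x) :
    c.1.EncodedBy (x.2.1 ++ x.1.toList) := by
  obtain ⟨-, vs, hp, hm⟩ := h
  exact hm ▸ hp.encodedBy

variable [Finite S]

theorem represents_init (A : QDAS Q Γ X D S) :
    A.Represents A.initConfig A.toPDSD.initConfig :=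
  ⟨rfl, [0], A.initCTG_isTaskPath, rfl⟩

theorem toPDSD_mem_of_mem {A : QDAS Q Γ X D S} {r : S × QAct Q Γ X D × S} (hr : r ∈ A.rules) :
    A.toPDSDRule r ∈ A.toPDSD.rules :=
  Or.inl ⟨r, hr, rfl⟩

theorem toPDSD_mem_of_final {A : QDAS Q Γ X D S} {s : S} (hs : s = A.final (A.blockOf s))
    (y : Option S) :
    (some s, y.elim (PDAct.internal 0) PDAct.pop, y) ∈ A.toPDSD.rules :=
  Or.inr ⟨(s, y), hs, rfl⟩

/-- The pushdown system simulates the QDAS, as long as it is not in the state `none` with a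
nonempty stack. -/
theorem Represents.toPDSD_step {A : QDAS Q Γ X D S} (hsync : A.Synchronous)
    {c c' : QConfig Q Γ X D S} {l : Option (QAct Q Γ X D)} {x : Option S × List S × (X → D)}
    (h : A.Represents c x) (hx : x.1 = none → x.2.1 = []) (hc : A.StepAtomic c l c') :
    ∃ l' x', A.toPDSD.Step x l' x' ∧ A.Represents c' x' ∧ (x'.1 = none → x'.2.1 = []) := by
  obtain ⟨y, w, e⟩ := x
  obtain ⟨hd, vs, hp, hm⟩ := h
  have top : ∀ v, c.1.Unblocked v →
      ∃ us, vs = us ++ [v] ∧ w = us.map c.1.st ∧ y = some (c.1.st v) := by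
    intro v hv
    obtain ⟨us, rfl⟩ := hp.eq_append_of_unblocked hv
    refine ⟨us, rfl, ?_⟩
    cases y with
    | none => have hw : w = [] := hx rfl; simp [hw] at hm
    | some s =>
      rw [List.map_append] at hm
      have := List.append_inj' hm (by simp)
      exact ⟨this.1.symm, by simpa using this.2.symm⟩
  cases hc with
  | @guard G d v g s' ht hv hr hg =>
    obtain ⟨us, rfl, rfl, rfl⟩ := top v hv
    cases hd
    exact ⟨_, _, .guard (toPDSD_mem_of_mem hr) hg,
      ⟨rfl, _, hp.setSt (A.rules_block _ hr), hp.map_setSt s'⟩, by simp⟩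
  | @assign G d v x dd s' ht hv hr =>
    obtain ⟨us, rfl, rfl, rfl⟩ := top v hv
    cases hd
    exact ⟨_, _, .assign (toPDSD_mem_of_mem hr),
      ⟨rfl, _, hp.setSt (A.rules_block _ hr), hp.map_setSt s'⟩, by simp⟩
  | @dispatchA G d v q γ s' v' ht hv hr hv' => exact absurd rfl (hsync _ hr q γ)
  | @dispatchS G d v q γ s' v' ht hv hr hv' =>
    obtain ⟨us, rfl, rfl, rfl⟩ := top v hv
    cases hd
    have hp' := hp.setSt (A.rules_block _ hr)
    exact ⟨_, _, .push (toPDSD_mem_of_mem hr),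
      ⟨rfl, _, hp'.addTask hv' q γ,
        (hp'.map_addTask hv' q γ _).trans (by rw [hp.map_setSt]; rfl)⟩, by simp⟩
  | @schedErase G d v ht hv hf =>
    obtain ⟨us, rfl, rfl, rfl⟩ := top v hv
    cases hd
    rw [hp.lab_eq v (by simp)] at hf
    rcases List.eq_nil_or_concat us with rfl | ⟨ps, t, rfl⟩
    · exact ⟨_, _, .internal (toPDSD_mem_of_final hf none), ⟨rfl, _, hp.erase, rfl⟩, fun _ => rfl⟩
    · refine ⟨PDAct.pop (G.st t), (some (G.st t), ps.map G.st, e), ?_,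
        ⟨rfl, _, hp.erase, by simp [CTG.erase]⟩, by simp⟩
      have := PDSD.Step.pop (w := ps.map G.st) (d := e)
        (toPDSD_mem_of_final hf (some (G.st t)))
      simpa using this
  | schedDequeue hh _ => exact absurd hh (hp.not_isHead _)

/-- The QDAS simulates the pushdown system. -/
theorem Represents.stepAtomic {A : QDAS Q Γ X D S} (hsync : A.Synchronous)
    {c : QConfig Q Γ X D S} {l : PDAct S X D} {x x' : Option S × List S × (X → D)}
    (h : A.Represents c x) (hx : A.toPDSD.Step x l x') :
    ∃ l' c', A.StepAtomic c l' c' ∧ A.Represents c' x' := by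
  obtain ⟨G, d⟩ := c
  obtain ⟨y, w, e⟩ := x
  obtain ⟨rfl, vs, hp, hm⟩ := h
  have top : ∀ s, y = some s →
      ∃ us v, vs = us ++ [v] ∧ w = us.map G.st ∧ G.st v = s := by
    rintro s rfl
    rcases List.eq_nil_or_concat vs with rfl | ⟨us, v, rfl⟩
    · simp at hm
    · simp only [List.concat_eq_append, List.map_append] at hm ⊢
      have := List.append_inj' hm (by simp)
      exact ⟨us, v, rfl, this.1.symm, by simpa using this.2⟩
  have fire : ∀ a y', (y, a, y') ∈ A.toPDSD.rules →
      (∃ us v q s', vs = us ++ [v] ∧ w = us.map G.st ∧ (G.st v, q, s') ∈ A.rules ∧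
        A.toPDSDRule (G.st v, q, s') = (y, a, y')) ∨
      ∃ us v, vs = us ++ [v] ∧ w = us.map G.st ∧ G.st v = A.final (G.lab v) ∧
        a = y'.elim (PDAct.internal 0) PDAct.pop := by
    rintro a y' (⟨⟨s, q, s'⟩, hr, he⟩ | ⟨⟨s, z⟩, hf, he⟩)
    · obtain ⟨us, v, hvs, hw, rfl⟩ := top s (by cases q <;> cases he <;> rfl)
      exact Or.inl ⟨us, v, q, s', hvs, hw, hr, he⟩
    · cases he
      obtain ⟨us, v, rfl, hw, rfl⟩ := top s rfl
      exact Or.inr ⟨us, v, rfl, hw, by rw [hp.lab_eq v (by simp)]; exact hf, rfl⟩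
  have fin : ∀ us v y', vs = us ++ [v] → G.st v = A.final (G.lab v) →
      ∀ w', us.map G.st = w' ++ y'.toList →
      ∃ l' c', A.StepAtomic (G, d) l' c' ∧ A.Represents c' (y', w', d) := by
    rintro us v y' rfl hf w' hw'
    exact ⟨_, _, .schedErase (hp.task v (by simp)) hp.unblocked_last hf, rfl, us, hp.erase, hw'⟩
  cases hx with
  | @push _ y' φ _ _ hr =>
    obtain ⟨us, v, q, s', rfl, rfl, hq, he⟩ | ⟨_, _, _, _, _, he⟩ := fire _ _ hr
    · cases q with
      | dispatchA q γ => exact absurd rfl (hsync _ hq q γ)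
      | dispatchS q γ =>
        cases he
        obtain ⟨v', hv'⟩ := Infinite.exists_notMem_finset G.verts
        have hp' := hp.setSt (A.rules_block _ hq)
        exact ⟨_, _, .dispatchS (hp.task v (by simp)) hp.unblocked_last hq hv', rfl, _,
          hp'.addTask hv' q γ, (hp'.map_addTask hv' q γ _).trans (by rw [hp.map_setSt]; rfl)⟩
      | _ => cases he
    · cases y' <;> cases he
  | @pop _ y' φ w' _ hr =>
    obtain ⟨us, v, q, s', rfl, _, hq, he⟩ | ⟨us, v, hvs, hw, hf, he⟩ := fire _ _ hr
    · cases q <;> cases he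
    · cases y' with
      | none => cases he
      | some t => cases he; exact fin us v _ hvs hf _ hw.symm
  | @guard _ y' g _ _ hr hg =>
    obtain ⟨us, v, q, s', rfl, rfl, hq, he⟩ | ⟨_, _, _, _, _, he⟩ := fire _ _ hr
    · cases q <;> cases he
      exact ⟨_, _, .guard (hp.task v (by simp)) hp.unblocked_last hq hg, rfl, _,
        hp.setSt (A.rules_block _ hq), hp.map_setSt s'⟩
    · cases y' <;> cases he
  | @assign _ y' x dd _ _ hr =>
    obtain ⟨us, v, q, s', rfl, rfl, hq, he⟩ | ⟨_, _, _, _, _, he⟩ := fire _ _ hr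
    · cases q <;> cases he
      exact ⟨_, _, .assign (hp.task v (by simp)) hp.unblocked_last hq, rfl, _,
        hp.setSt (A.rules_block _ hq), hp.map_setSt s'⟩
    · cases y' <;> cases he
  | @internal _ y' n _ _ hr =>
    obtain ⟨us, v, q, s', rfl, _, hq, he⟩ | ⟨us, v, hvs, hw, hf, he⟩ := fire _ _ hr
    · cases q <;> cases he
    · cases y' with
      | none => exact fin us v _ hvs hf _ (by simpa using hw.symm)
      | some t => cases he

end QDAS

/-- For every synchronous QDAS `A` (with the atomic convention for
synchronous dispatches) one can construct a pushdown system with data, with stack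
alphabet `S`, the same variables `X` over `D` and the same initial value, whose states
are `Option S` (`none` playing the role of ε, so that a configuration `(y, w, d')`
encodes the word `w ++ y.toList`), such that runs of `A` and runs of `P` of the same
length correspond, configuration-wise: the valuations agree and the CTG `Gᵢ` is
encoded by the word `wᵢ ⬝ sᵢ`; and vice versa. -/
theorem sync_qdas_equiv_pds_with_data
    {Q Γ X D S : Type} [Fintype Q] [Fintype Γ] [Fintype X] [Fintype D] [Fintype S]
    (A : QDAS Q Γ X D S) (hsync : A.Synchronous) :
    ∃ P : PDSD (Option S) S X D,
      P.d0 = A.d0 ∧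
      (∀ (n : ℕ) (cs : ℕ → QConfig Q Γ X D S) (las : ℕ → Option (QAct Q Γ X D)),
        IsRun A.StepAtomic A.initConfig n cs las →
        ∃ (xs : ℕ → Option S × List S × (X → D)) (lbs : ℕ → PDAct S X D),
          IsRun P.Step P.initConfig n xs lbs ∧
          ∀ i ≤ n, (cs i).2 = (xs i).2.2 ∧
            (cs i).1.EncodedBy ((xs i).2.1 ++ (xs i).1.toList)) ∧
      (∀ (n : ℕ) (xs : ℕ → Option S × List S × (X → D)) (lbs : ℕ → PDAct S X D),
        IsRun P.Step P.initConfig n xs lbs →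
        ∃ (cs : ℕ → QConfig Q Γ X D S) (las : ℕ → Option (QAct Q Γ X D)),
          IsRun A.StepAtomic A.initConfig n cs las ∧
          ∀ i ≤ n, (cs i).2 = (xs i).2.2 ∧
            (cs i).1.EncodedBy ((xs i).2.1 ++ (xs i).1.toList)) := by
  refine ⟨A.toPDSD, rfl, fun n cs las hrun => ?_, fun n xs lbs hrun => ?_⟩
  · obtain ⟨xs, lbs, hxs, hR⟩ := hrun.simulate
      (R := fun c x => A.Represents c x ∧ (x.1 = none → x.2.1 = []))
      ⟨PDAct.internal 0⟩ ⟨A.represents_init, fun _ => rfl⟩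
      fun c l c' x h hc => h.1.toPDSD_step hsync h.2 hc
    exact ⟨xs, lbs, hxs, fun i hi => ⟨(hR i hi).1.1, (hR i hi).1.encodedBy⟩⟩
  · obtain ⟨cs, las, hcs, hR⟩ := hrun.simulate (R := fun x c => A.Represents c x)
      ⟨none⟩ A.represents_init fun x l x' c h hx => h.stepAtomic hsync hx
    exact ⟨cs, las, hcs, fun i hi => ⟨(hR i hi).1, (hR i hi).encodedBy⟩⟩
end

section
/- Let A be a synchronous QDAS with CQID empty (all queues serial). Then every task vertex other than the one running main occurring in a reachable CTG of A was dequeued from a serial queue, and distinct such task vertices come from distinct serial queues; consequently, in every reachable configuration (G,d) of A, the CTG G has at most |SQID| + 2 vertices. -/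
open scoped Classical

namespace CTG

variable {Q Γ S : Type}

/-- The vertices of `G` are stacked as in `l` (top first): every vertex below the top is a task
vertex waiting for the vertex just above it, tasks of the same queue coincide, and a call vertex
whose queue has a task is blocked. Every vertex without a queue runs `main`. -/
structure IsStack (G : CTG Q Γ S) (main : Γ) (l : List ℕ) : Prop where
  nodup : l.Nodup
  mem_iff : ∀ v, v ∈ G.verts ↔ v ∈ l
  chain : l.IsChain fun a b => G.wEdge b a
  task_of_mem_tail : ∀ v ∈ l.tail, G.task v
  queueOf_inj : ∀ v ∈ G.verts, ∀ u ∈ G.verts, G.task v → G.task u →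
    G.queueOf v = G.queueOf u → v = u
  lab_eq_main : ∀ v ∈ G.verts, G.queueOf v = none → G.lab v = main
  call_blocked : ∀ v ∈ G.verts, ∀ u ∈ G.verts, ¬ G.task v → G.task u →
    G.queueOf v = G.queueOf u → ∃ b, G.wEdge v b

end CTG

theorem List.IsChain.exists_rel_of_mem {α : Type*} {R : α → α → Prop} {a : α} {l : List α}
    (h : (a :: l).IsChain R) {v : α} (hv : v ∈ l) : ∃ b, R b v := by
  induction l generalizing a with
  | nil => simp at hv
  | cons c l ih =>
    rw [List.isChain_cons_cons] at h
    rcases List.mem_cons.1 hv with rfl | hv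
    · exact ⟨a, h.1⟩
    · exact ih h.2 hv

namespace CTG.IsStack

variable {Q Γ S : Type} {G : CTG Q Γ S} {main : Γ} {l : List ℕ} {v : ℕ}

/-- Only the top of the stack can be unblocked. -/
theorem eq_cons_of_unblocked (h : G.IsStack main l) (hv : G.Unblocked v) :
    ∃ t, l = v :: t := by
  have hm := (h.mem_iff v).1 hv.1
  have hc := h.chain
  cases l with
  | nil => simp at hm
  | cons a t =>
    rcases List.mem_cons.1 hm with rfl | hm
    · exact ⟨t, rfl⟩
    · obtain ⟨b, hb⟩ := hc.exists_rel_of_mem hm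
      exact absurd (Or.inr hb) (hv.2 b)

theorem setSt (h : G.IsStack main l) (v : ℕ) (s : S) : (G.setSt v s).IsStack main l :=
  ⟨h.nodup, h.mem_iff, h.chain, h.task_of_mem_tail, h.queueOf_inj, h.lab_eq_main,
    h.call_blocked⟩

theorem enqueue_addWait {t : List ℕ} (h : G.IsStack main (v :: t)) (hv : G.task v)
    {p : Prop} (hp : p) (q : Q) (γ : Γ) (s : S) {v' : ℕ} (hv' : v' ∉ G.verts) :
    ((G.enqueue p q γ s v').addWait v v').IsStack main (v' :: v :: t) := by
  have hne : ∀ u ∈ G.verts, u ≠ v' := fun u hu e => hv' (e ▸ hu)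
  have htask : ∀ u ∈ G.verts, G.task u := by
    intro u hu
    rcases List.mem_cons.1 ((h.mem_iff u).1 hu) with rfl | hu
    · exact hv
    · exact h.task_of_mem_tail u hu
  refine ⟨List.nodup_cons.2 ⟨fun hm => hv' ((h.mem_iff v').2 hm), h.nodup⟩, fun u => ?_, ?_,
    fun u hu => ?_, ?_, ?_, ?_⟩
  · simp [addWait, enqueue, h.mem_iff]
  · rw [List.isChain_cons_cons]
    exact ⟨Or.inr ⟨rfl, rfl⟩, h.chain.imp fun a b hab => Or.inl (Or.inl hab)⟩
  · have hu : u ∈ G.verts := (h.mem_iff u).2 hu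
    exact ⟨hne u hu, htask u hu⟩
  · rintro u hu w hw ⟨hu1, hu2⟩ ⟨hw1, hw2⟩ he
    simp only [addWait, enqueue, Function.update_of_ne hu1, Function.update_of_ne hw1,
      Finset.mem_insert, hu1, hw1, false_or] at hu hw he
    exact h.queueOf_inj u hu w hw hu2 hw2 he
  · intro u hu he
    by_cases hu1 : u = v'
    · subst hu1
      simp [addWait, enqueue] at he
    · simp only [addWait, enqueue, Function.update_of_ne hu1, Finset.mem_insert, hu1,
        false_or] at hu he ⊢
      exact h.lab_eq_main u hu he
  · rintro u hu w hw hnu ⟨hw1, hw2⟩ he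
    have hu1 : u = v' := by
      by_contra hu1
      exact hnu ⟨hu1, htask u ((Finset.mem_insert.1 hu).resolve_left hu1)⟩
    subst hu1
    simp only [addWait, enqueue, Function.update_self, Function.update_of_ne hw1,
      Finset.mem_insert, hw1, false_or] at hw he
    exact ⟨w, Or.inl (Or.inr ⟨hp, rfl, hw, hw2, he.symm⟩)⟩

theorem erase {t : List ℕ} (h : G.IsStack main (v :: t)) : (G.erase v).IsStack main t := by
  have hnd := List.nodup_cons.1 h.nodup
  have hne : ∀ u ∈ t, u ≠ v := fun u hu e => hnd.1 (e ▸ hu)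
  have hmem : ∀ u, u ∈ (G.erase v).verts ↔ u ∈ t := by
    intro u
    simp only [CTG.erase, Finset.mem_erase, h.mem_iff, List.mem_cons]
    exact ⟨fun hu => hu.2.resolve_left hu.1, fun hu => ⟨hne u hu, Or.inr hu⟩⟩
  have hsub : ∀ u ∈ (G.erase v).verts, u ∈ G.verts := fun u hu => Finset.mem_of_mem_erase hu
  have htask : ∀ u ∈ t, G.task u := h.task_of_mem_tail
  refine ⟨hnd.2, hmem, ?_, fun u hu => htask u (List.mem_of_mem_tail hu),
    fun u hu w hw => h.queueOf_inj u (hsub u hu) w (hsub w hw),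
    fun u hu => h.lab_eq_main u (hsub u hu),
    fun u hu _ _ hnu => absurd (htask u ((hmem u).1 hu)) hnu⟩
  refine h.chain.tail.imp_of_mem_imp fun a b ha hb hab => ?_
  exact ⟨hab, hne b hb, hne a ha⟩

theorem dequeue (h : G.IsStack main l) (hv : G.Unblocked v) (hnv : ¬ G.task v) (p : Prop) :
    (G.dequeue p v).IsStack main l := by
  have hfree : ∀ u ∈ G.verts, G.task u → G.queueOf v ≠ G.queueOf u := fun u hu htu he =>
    (h.call_blocked v hv.1 u hu hnv htu he).elim fun b hb => hv.2 b (Or.inr hb)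
  refine ⟨h.nodup, h.mem_iff, h.chain.imp fun _ _ => Or.inl,
    fun u hu => Or.inr (h.task_of_mem_tail u hu), ?_, h.lab_eq_main, ?_⟩
  · rintro u hu w hw (rfl | htu) (rfl | htw) he
    · rfl
    · exact absurd he (hfree w hw htw)
    · exact absurd he.symm (hfree u hu htu)
    · exact h.queueOf_inj u hu w hw htu htw he
  · rintro u hu w hw hnu htw he
    obtain ⟨t, rfl⟩ := h.eq_cons_of_unblocked hv
    rcases List.mem_cons.1 ((h.mem_iff u).1 hu) with rfl | hut
    · exact absurd (Or.inl rfl) hnu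
    · exact absurd (Or.inr (h.task_of_mem_tail u hut)) hnu

theorem card_le [Fintype Q] (h : G.IsStack main l) : G.verts.card ≤ Fintype.card Q + 2 := by
  have htasks : (G.verts.filter G.task).card ≤ Fintype.card Q + 1 := by
    rw [← Fintype.card_option, ← Finset.card_univ]
    refine Finset.card_le_card_of_injOn G.queueOf (fun _ _ => Finset.mem_univ _) ?_
    intro u hu w hw he
    simp only [Finset.coe_filter, Set.mem_ofPred_eq] at hu hw
    exact h.queueOf_inj u hu.1 w hw.1 hu.2 hw.2 he
  have hcalls : (G.verts.filter fun v => ¬ G.task v).card ≤ 1 := by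
    have htop : ∀ u ∈ G.verts, ¬ G.task u → l.head? = some u := by
      intro u hu hnu
      have hm := (h.mem_iff u).1 hu
      have ht := h.task_of_mem_tail u
      cases l with
      | nil => simp at hm
      | cons a t =>
        rcases List.mem_cons.1 hm with rfl | hm
        · rfl
        · exact absurd (ht hm) hnu
    refine Finset.card_le_one.2 fun u hu w hw => ?_
    rw [Finset.mem_filter] at hu hw
    exact Option.some.inj ((htop u hu.1 hu.2).symm.trans (htop w hw.1 hw.2))
  have := Finset.card_filter_add_card_filter_not (s := G.verts) G.task
  omega

end CTG.IsStack

namespace QDAS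

variable {Q Γ X D S : Type} {A : QDAS Q Γ X D S}

theorem isStack_initCTG : A.initCTG.IsStack A.main [0] := by
  constructor <;> simp [initCTG]

theorem Step.exists_isStack (hsync : A.Synchronous) (hserial : ∀ q, A.serial q)
    {c c' : QConfig Q Γ X D S} {a : Option (QAct Q Γ X D)} (hstep : A.Step c a c')
    (h : ∃ l, c.1.IsStack A.main l) : ∃ l, c'.1.IsStack A.main l := by
  obtain ⟨l, h⟩ := h
  cases hstep with
  | guard => exact ⟨l, h.setSt _ _⟩
  | assign => exact ⟨l, h.setSt _ _⟩
  | dispatchA _ _ hr => exact absurd rfl (hsync _ hr _ _)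
  | dispatchS ht hu _ hv' =>
    obtain ⟨t, rfl⟩ := h.eq_cons_of_unblocked hu
    exact ⟨_, (h.setSt _ _).enqueue_addWait ht (hserial _) _ _ _ hv'⟩
  | schedErase _ hu _ =>
    obtain ⟨t, rfl⟩ := h.eq_cons_of_unblocked hu
    exact ⟨t, h.erase⟩
  | schedDequeue hh hb => exact ⟨l, h.dequeue ⟨hh.1, hb⟩ hh.2.1 _⟩

theorem exists_isStack_of_mem_reach (hsync : A.Synchronous) (hserial : ∀ q, A.serial q)
    {c : QConfig Q Γ X D S} (hc : c ∈ A.Reach) : ∃ l, c.1.IsStack A.main l := by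
  induction hc with
  | refl => exact ⟨_, isStack_initCTG⟩
  | tail _ hstep ih =>
    obtain ⟨a, hstep⟩ := hstep
    exact hstep.exists_isStack hsync hserial ih

end QDAS

/-- In a synchronous QDAS all of whose queues are serial
(`CQID = ∅`), in every reachable configuration `(G, d)`: every task vertex other
than the one running `main` was dequeued from a (serial) queue, distinct such task
vertices come from distinct serial queues, and consequently `G` has at most
`|SQID| + 2` vertices. -/
theorem serial_sync_qdas_bounded_ctg
    {Q Γ X D S : Type} [Fintype Q] [Fintype Γ] [Fintype X] [Fintype D] [Fintype S]
    (A : QDAS Q Γ X D S) (hsync : A.Synchronous) (hserial : ∀ q, A.serial q) :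
    ∀ (G : CTG Q Γ S) (d : X → D), (G, d) ∈ A.Reach →
      (∀ v ∈ G.verts, G.task v → G.lab v ≠ A.main →
        ∃ q : Q, A.serial q ∧ G.queueOf v = some q) ∧
      (∀ v ∈ G.verts, ∀ v' ∈ G.verts, G.task v → G.task v' →
        G.lab v ≠ A.main → G.lab v' ≠ A.main → v ≠ v' →
        G.queueOf v ≠ G.queueOf v') ∧
      G.verts.card ≤ Fintype.card Q + 2 := by
  intro G d hG
  obtain ⟨l, h⟩ := QDAS.exists_isStack_of_mem_reach hsync hserial hG
  refine ⟨fun v hv _ hlab => ?_, fun v hv v' hv' ht ht' _ _ hne he =>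
    hne (h.queueOf_inj v hv v' hv' ht ht' he), h.card_le⟩
  obtain ⟨q, hq⟩ := Option.ne_none_iff_exists'.1 fun he => hlab (h.lab_eq_main v hv he)
  exact ⟨q, hserial q, hq⟩
end

section
/- For every concurrent asynchronous QDAS A with set of states S, one can build a Petri net N_A whose set of places contains S, such that for every function f : S -> N: f is Parikh-coverable in A if and only if the marking m defined by m(s) = f(s) for every s in S and m(p) = 0 for every other place p belongs to Cover(N_A). -/
open scoped Classical

namespace CTG

variable {Q Γ S : Type}

theorem parikh_eq_sum (G : CTG Q Γ S) (s : S) :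
    G.parikh s = ∑ v ∈ G.verts, if G.st v = s then 1 else 0 :=
  Finset.card_filter _ _

theorem exists_of_parikh_pos {G : CTG Q Γ S} {s : S} (h : 1 ≤ G.parikh s) :
    ∃ v ∈ G.verts, G.st v = s := by
  obtain ⟨v, hv⟩ := Finset.card_pos.mp h
  exact ⟨v, Finset.mem_filter.mp hv⟩

theorem parikh_pos {G : CTG Q Γ S} {v : ℕ} (hv : v ∈ G.verts) : 1 ≤ G.parikh (G.st v) :=
  Finset.card_pos.mpr ⟨v, Finset.mem_filter.mpr ⟨hv, rfl⟩⟩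

theorem parikh_setSt {G : CTG Q Γ S} {v : ℕ} (hv : v ∈ G.verts) (s' t : S) :
    (G.setSt v s').parikh t + (if t = G.st v then 1 else 0) =
      G.parikh t + (if t = s' then 1 else 0) := by
  have hrest : ∑ u ∈ G.verts.erase v, (if (G.setSt v s').st u = t then 1 else 0) =
      ∑ u ∈ G.verts.erase v, if G.st u = t then 1 else 0 := by
    refine Finset.sum_congr rfl fun u hu => ?_
    simp [setSt, Function.update_of_ne (Finset.ne_of_mem_erase hu)]
  have hnew : (G.setSt v s').st v = s' := by simp [setSt]
  rw [parikh_eq_sum, parikh_eq_sum, ← Finset.add_sum_erase G.verts _ hv]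
  change (∑ u ∈ G.verts, _) + _ = _
  rw [← Finset.add_sum_erase G.verts _ hv, hrest, hnew]
  simp only [eq_comm (a := t)]
  omega

theorem parikh_enqueue {G : CTG Q Γ S} {v' : ℕ} (hv' : v' ∉ G.verts) (p : Prop) (q : Q) (γ : Γ)
    (s0 t : S) :
    (G.enqueue p q γ s0 v').parikh t = G.parikh t + (if t = s0 then 1 else 0) := by
  rw [parikh_eq_sum, parikh_eq_sum]
  change ∑ u ∈ insert v' G.verts, _ = _
  rw [Finset.sum_insert hv', add_comm]
  congr 1
  · refine Finset.sum_congr rfl fun u hu => ?_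
    have : u ≠ v' := fun h => hv' (h ▸ hu)
    simp [enqueue, Function.update_of_ne this]
  · simp [enqueue, eq_comm]

theorem parikh_erase_le (G : CTG Q Γ S) (v : ℕ) (t : S) : (G.erase v).parikh t ≤ G.parikh t :=
  Finset.card_le_card (Finset.filter_subset_filter _ (Finset.erase_subset _ _))

/-- No call is pending and nothing is blocked. -/
def AllRunning (G : CTG Q Γ S) : Prop :=
  (∀ v ∈ G.verts, G.task v) ∧ ∀ a b, ¬ G.edge a b

end CTG

namespace QDAS

variable {Q Γ X D S : Type}

/-- `A.Move s d s' d' c`: under valuation `d`, some rule takes a task from state `s` to `s'`,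
changes the valuation to `d'`, and, if `c = some u`, creates a call in state `u`. -/
inductive Move (A : QDAS Q Γ X D S) : S → (X → D) → S → (X → D) → Option S → Prop
  | guard {s s' : S} {d : X → D} {g : List (X × D × Bool)} :
      (s, QAct.guard g, s') ∈ A.rules → GuardSat d g → Move A s d s' d none
  | assign {s s' : S} {d : X → D} {x : X} {e : D} :
      (s, QAct.assign x e, s') ∈ A.rules → Move A s d s' (Function.update d x e) none
  | dispatch {s s' : S} {d : X → D} {q : Q} {γ : Γ} :
      (s, QAct.dispatchA q γ, s') ∈ A.rules → Move A s d s' d (some (A.init γ))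

theorem Step.parikh_le_or_move {A : QDAS Q Γ X D S} (hasync : A.Asynchronous)
    {c c' : QConfig Q Γ X D S} {a : Option (QAct Q Γ X D)} (h : A.Step c a c') :
    (c'.2 = c.2 ∧ ∀ t, c'.1.parikh t ≤ c.1.parikh t) ∨
    ∃ s s' o, A.Move s c.2 s' c'.2 o ∧ 1 ≤ c.1.parikh s ∧
      ∀ t, c'.1.parikh t + (if t = s then 1 else 0) =
        c.1.parikh t + (if t = s' then 1 else 0) + (if o = some t then 1 else 0) := by
  cases h with
  | guard _ hu hr hg =>
    exact .inr ⟨_, _, _, .guard hr hg, CTG.parikh_pos hu.1,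
      fun t => by simpa using CTG.parikh_setSt hu.1 _ t⟩
  | assign _ hu hr =>
    exact .inr ⟨_, _, _, .assign hr, CTG.parikh_pos hu.1,
      fun t => by simpa using CTG.parikh_setSt hu.1 _ t⟩
  | @dispatchA G d v q γ s' v' _ hu hr hv' =>
    refine .inr ⟨_, _, _, .dispatch hr, CTG.parikh_pos hu.1, fun t => ?_⟩
    have h1 := CTG.parikh_setSt hu.1 s' t
    have h2 := CTG.parikh_enqueue (G := G.setSt v s') hv' (A.serial q) q γ (A.init γ) t
    simp only [Option.some.injEq, eq_comm (a := A.init γ)]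
    omega
  | dispatchS _ _ hr _ => exact absurd rfl (hasync _ hr _ _)
  | schedErase => exact .inl ⟨rfl, fun t => CTG.parikh_erase_le _ _ t⟩
  | schedDequeue => exact .inl ⟨rfl, fun _ => le_rfl⟩

/-- A move can be realised from an `AllRunning` configuration so that no call is left pending:
a dispatched call is immediately turned into a task. -/
theorem Move.exists_reach {A : QDAS Q Γ X D S} (hconc : ∀ q, ¬ A.serial q)
    {s s' : S} {d d' : X → D} {o : Option S} (h : A.Move s d s' d' o)
    {G : CTG Q Γ S} (hreach : (G, d) ∈ A.Reach) (hG : G.AllRunning) (hs : 1 ≤ G.parikh s) :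
    ∃ G' : CTG Q Γ S, (G', d') ∈ A.Reach ∧ G'.AllRunning ∧
      ∀ t, G'.parikh t + (if t = s then 1 else 0) =
        G.parikh t + (if t = s' then 1 else 0) + (if o = some t then 1 else 0) := by
  obtain ⟨v, hv, rfl⟩ := CTG.exists_of_parikh_pos hs
  have hu : G.Unblocked v := ⟨hv, hG.2 v⟩
  cases h with
  | guard hr hg =>
    exact ⟨G.setSt v s', hreach.tail ⟨_, .guard (hG.1 v hv) hu hr hg⟩, hG,
      fun t => by simpa using CTG.parikh_setSt hv s' t⟩
  | assign hr =>
    exact ⟨G.setSt v s', hreach.tail ⟨_, .assign (hG.1 v hv) hu hr⟩, hG,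
      fun t => by simpa using CTG.parikh_setSt hv s' t⟩
  | @dispatch _ _ q γ hr =>
    obtain ⟨v', hv'⟩ := Infinite.exists_notMem_finset G.verts
    have hnoTail (b : ℕ) : ¬ (G.setSt v s').IsTail q b := fun hb => hb.2.1 (hG.1 b hb.1)
    have hnoEdge (a b : ℕ) :
        ¬ ((G.setSt v s').enqueue (A.serial q) q γ (A.init γ) v').edge a b := by
      rintro ((h | h) | (h | h))
      · exact hG.2 a b (.inl h)
      · exact hnoTail b h.2
      · exact hG.2 a b (.inr h)
      · exact hconc q h.1
    have hhead : ((G.setSt v s').enqueue (A.serial q) q γ (A.init γ) v').IsHead q v' :=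
      ⟨Finset.mem_insert_self _ _, fun h => h.1 rfl, by simp [CTG.enqueue],
        fun b h => hnoEdge v' b (.inl h)⟩
    refine ⟨((G.setSt v s').enqueue (A.serial q) q γ (A.init γ) v').dequeue (A.serial q) v',
      (hreach.tail ⟨_, .dispatchA (hG.1 v hv) hu hr hv'⟩).tail
        ⟨_, .schedDequeue hhead (hnoEdge v')⟩, ⟨?_, ?_⟩, fun t => ?_⟩
    · intro u hmem
      rcases Finset.mem_insert.mp hmem with h | h
      · exact .inl h
      · by_cases huv : u = v'
        · exact .inl huv
        · exact .inr ⟨huv, hG.1 u h⟩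
    · rintro a b (h | (h | h))
      · exact hnoEdge a b (.inl h.1)
      · exact hnoEdge a b (.inr h)
      · exact hconc q h.1
    · change ((G.setSt v s').enqueue (A.serial q) q γ (A.init γ) v').parikh t + _ = _
      have h1 := CTG.parikh_setSt hv s' t
      have h2 := CTG.parikh_enqueue (G := G.setSt v s') hv' (A.serial q) q γ (A.init γ) t
      simp only [Option.some.injEq, eq_comm (a := A.init γ)]
      omega

/-- Places of the Petri net of a QDAS: a place per state, counting the vertices in that state;
a place per state for freshly created calls; and a place per valuation, the current one being
marked. -/
abbrev Place (X D S : Type) : Type := S ⊕ S ⊕ (X → D)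

/-- The net transition of a move. Fresh calls go to their own places since arc weights
are at most one. -/
noncomputable def moveTrans (s : S) (d : X → D) (s' : S) (d' : X → D) (o : Option S) :
    (Place X D S → Bool) × (Place X D S → Bool) :=
  (Sum.elim (fun t => decide (t = s)) (Sum.elim (fun _ => false) fun e => decide (e = d)),
   Sum.elim (fun t => decide (t = s'))
    (Sum.elim (fun t => decide (o = some t)) fun e => decide (e = d')))

/-- The net transition moving a fresh call to the place of its state. -/
noncomputable def callTrans (X D : Type) (u : S) :
    (Place X D S → Bool) × (Place X D S → Bool) :=
  (Sum.elim (fun _ => false) (Sum.elim (fun t => decide (t = u)) fun _ => false),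
   Sum.elim (fun t => decide (t = u)) fun _ => false)

/-- The Petri net of a concurrent asynchronous QDAS. -/
noncomputable def toPetriNet [Finite X] [Finite D] [Finite S] (A : QDAS Q Γ X D S) :
    PetriNet (Place X D S) where
  trans := {t | (∃ s d s' d' o, A.Move s d s' d' o ∧ t = moveTrans s d s' d' o) ∨
    ∃ u, t = callTrans X D u}
  trans_fin := Set.toFinite _
  m0 := Sum.elim (fun t => if t = A.init A.main then 1 else 0)
    (Sum.elim (fun _ => 0) fun e => if e = fun _ => A.d0 then 1 else 0)

theorem parikh_initCTG (A : QDAS Q Γ X D S) (t : S) :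
    A.initCTG.parikh t = if t = A.init A.main then 1 else 0 := by
  simp [CTG.parikh_eq_sum, initCTG, eq_comm]

section

variable [Finite X] [Finite D] [Finite S] {A : QDAS Q Γ X D S}

theorem exists_marking_of_reach (hasync : A.Asynchronous) {c : QConfig Q Γ X D S}
    (hc : c ∈ A.Reach) :
    ∃ M ∈ A.toPetriNet.Reach, (∀ t, c.1.parikh t ≤ M (.inl t)) ∧ 1 ≤ M (.inr (.inr c.2)) := by
  induction hc with
  | refl =>
    refine ⟨_, .refl, fun t => (A.parikh_initCTG t).le, ?_⟩
    simp [toPetriNet, initConfig]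
  | @tail c c' _ hstep ih =>
    obtain ⟨M, hM, hle, hval⟩ := ih
    obtain ⟨a, hstep⟩ := hstep
    rcases hstep.parikh_le_or_move hasync with ⟨hd, hp⟩ | ⟨s, s', o, hmove, hs, hp⟩
    · exact ⟨M, hM, fun t => (hp t).trans (hle t), hd ▸ hval⟩
    have hsM : 1 ≤ M (.inl s) := hs.trans (hle s)
    let t₁ := moveTrans s c.2 s' c'.2 o
    let M₁ : Place X D S → ℕ := fun p => M p - PetriNet.inp t₁ p + PetriNet.out t₁ p
    have hfire : A.toPetriNet.Fires M M₁ := by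
      refine ⟨t₁, .inl ⟨_, _, _, _, _, hmove, rfl⟩, ?_, fun _ => rfl⟩
      rintro (t | t | e) <;> simp only [t₁, moveTrans, PetriNet.inp, Sum.elim_inl, Sum.elim_inr,
        decide_eq_true_eq, Bool.false_eq_true, if_false, zero_le]
      · split_ifs with h
        · exact h ▸ hsM
        · exact zero_le
      · split_ifs with h
        · exact h ▸ hval
        · exact zero_le
    have hM₁ : M₁ ∈ A.toPetriNet.Reach := hM.tail hfire
    have hst (t : S) : M₁ (.inl t) + (if t = s then 1 else 0) =
        M (.inl t) + if t = s' then 1 else 0 := by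
      simp only [M₁, t₁, moveTrans, PetriNet.inp, PetriNet.out, Sum.elim_inl, decide_eq_true_eq]
      by_cases h : t = s
      · subst h
        simp only [if_true]
        omega
      · simp [h]
    have hval₁ : 1 ≤ M₁ (.inr (.inr c'.2)) := by
      simp [M₁, t₁, moveTrans, PetriNet.out]
    cases o with
    | none =>
      refine ⟨M₁, hM₁, fun t => ?_, hval₁⟩
      have h1 := hp t
      have h2 := hst t
      have h3 := hle t
      simp only [reduceCtorEq, if_false] at h1
      omega
    | some u =>
      let t₂ := callTrans X D u
      let M₂ : Place X D S → ℕ := fun p => M₁ p - PetriNet.inp t₂ p + PetriNet.out t₂ p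
      have hcall : 1 ≤ M₁ (.inr (.inl u)) := by
        simp [M₁, t₁, moveTrans, PetriNet.out]
      have hfire₂ : A.toPetriNet.Fires M₁ M₂ := by
        refine ⟨t₂, .inr ⟨u, rfl⟩, ?_, fun _ => rfl⟩
        rintro (t | t | e) <;> simp only [t₂, callTrans, PetriNet.inp, Sum.elim_inl,
          Sum.elim_inr, decide_eq_true_eq, Bool.false_eq_true, if_false, zero_le]
        split_ifs with h
        · exact h ▸ hcall
        · exact zero_le
      refine ⟨M₂, hM₁.tail hfire₂, fun t => ?_, ?_⟩
      · have h1 := hp t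
        have h2 := hst t
        have h3 := hle t
        have h4 : M₂ (.inl t) = M₁ (.inl t) + if t = u then 1 else 0 := by
          simp [M₂, t₂, callTrans, PetriNet.inp, PetriNet.out]
        simp only [Option.some.injEq, eq_comm (a := u)] at h1
        omega
      · simpa [M₂, t₂, callTrans, PetriNet.inp, PetriNet.out] using hval₁

theorem exists_reach_of_marking (hconc : ∀ q, ¬ A.serial q) {M : Place X D S → ℕ}
    (hM : M ∈ A.toPetriNet.Reach) :
    ∃ (G : CTG Q Γ S) (d : X → D), (G, d) ∈ A.Reach ∧ G.AllRunning ∧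
      (∀ t, M (.inl t) + M (.inr (.inl t)) = G.parikh t) ∧
      ∀ e, M (.inr (.inr e)) = if e = d then 1 else 0 := by
  induction hM with
  | refl =>
    refine ⟨A.initCTG, fun _ => A.d0, .refl, ⟨fun v hv => Finset.mem_singleton.mp hv, ?_⟩,
      fun t => ?_, fun e => rfl⟩
    · rintro a b (h | h) <;> exact h
    · rw [A.parikh_initCTG]
      rfl
  | @tail M M' _ hfire ih =>
    obtain ⟨G, d, hreach, hG, hcount, hval⟩ := ih
    obtain ⟨_, ⟨s, d₁, s', d', o, hmove, rfl⟩ | ⟨u, rfl⟩, hen, heff⟩ := hfire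
    · have hd : d₁ = d := by
        have h := hen (.inr (.inr d₁))
        rw [hval] at h
        by_contra hne
        simp [moveTrans, PetriNet.inp, hne] at h
      subst hd
      have hs : 1 ≤ M (.inl s) := by simpa [moveTrans, PetriNet.inp] using hen (.inl s)
      obtain ⟨G', hreach', hG', hp⟩ :=
        hmove.exists_reach hconc hreach hG (by have := hcount s; omega)
      refine ⟨G', d', hreach', hG', fun t => ?_, fun e => ?_⟩
      · have h1 := hp t
        have h2 := hcount t
        have h3 := hen (.inl t)
        rw [heff, heff]
        simp only [moveTrans, PetriNet.inp, PetriNet.out, Sum.elim_inl, Sum.elim_inr,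
          decide_eq_true_eq, Bool.false_eq_true, if_false] at h3 ⊢
        omega
      · rw [heff, hval]
        simp [moveTrans, PetriNet.inp, PetriNet.out]
    · refine ⟨G, d, hreach, hG, fun t => ?_, fun e => ?_⟩
      · have h2 := hcount t
        have h3 := hen (.inr (.inl t))
        rw [heff, heff]
        simp only [callTrans, PetriNet.inp, PetriNet.out, Sum.elim_inl, Sum.elim_inr,
          decide_eq_true_eq, Bool.false_eq_true, if_false] at h3 ⊢
        omega
      · rw [heff, hval]
        simp [callTrans, PetriNet.inp, PetriNet.out]

end

end QDAS

/-- For every concurrent asynchronous QDAS `A` one can build a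
Petri net `N_A` whose places contain the states `S` of `A` (via an injection `ι`),
such that for every `f : S → ℕ`: `f` is Parikh-coverable in `A` iff the marking `m`
with `m (ι s) = f s` for all `s ∈ S` and `m p = 0` for every other place `p` belongs
to `Cover(N_A)`. -/
theorem conc_async_qdas_parikh_iff_pn_cover
    {Q Γ X D S : Type} [Fintype Q] [Fintype Γ] [Fintype X] [Fintype D] [Fintype S]
    (A : QDAS Q Γ X D S) (hasync : A.Asynchronous)
    (hconc : ∀ q, ¬ A.serial q) (hne : Nonempty Q) :
    ∃ (Pl : Type) (ι : S → Pl), Function.Injective ι ∧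
      ∃ N : PetriNet Pl,
        ∀ (f : S → ℕ) (m : Pl → ℕ),
          (∀ s, m (ι s) = f s) → (∀ p, (∀ s, ι s ≠ p) → m p = 0) →
          (A.ParikhCoverable f ↔ m ∈ N.Cover) := by
  refine ⟨QDAS.Place X D S, Sum.inl, Sum.inl_injective, A.toPetriNet, fun f m hm hm0 => ⟨?_, ?_⟩⟩
  · rintro ⟨c, hc, hf⟩
    obtain ⟨M, hM, hle, -⟩ := QDAS.exists_marking_of_reach hasync hc
    refine ⟨M, hM, fun p => ?_⟩
    rcases p with s | p
    · exact (hm s).le.trans ((hf s).trans (hle s))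
    · rw [hm0 _ fun s => Sum.inl_ne_inr]
      exact Nat.zero_le _
  · rintro ⟨M, hM, hle⟩
    obtain ⟨G, d, hreach, -, hcount, -⟩ := QDAS.exists_reach_of_marking hconc hM
    refine ⟨(G, d), hreach, fun s => ?_⟩
    rw [← hm s, ← hcount s]
    exact (hle _).trans (Nat.le_add_right _ _)
end

section
/- For every fifo system F with message alphabet M and every control state c of F, there exists an asynchronous QDAS A_F with exactly one queue, which is serial, together with a family of states (t_m) for m in M union {epsilon} of its blocks, such that: c is reachable in F if and only if there exists m in M union {epsilon} such that the function f_m, defined by f_m(t_m) = 1 and f_m(s) = 0 for every other state s, is Parikh-coverable in A_F. -/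
open scoped Classical

/-! ### Fifo systems -/

inductive FAct (M : Type) : Type
  | send (m : M)
  | recv (m : M)
  | eps

/-- A fifo system: finite control states with a single reliable fifo channel. -/
structure FifoSys (Sf M : Type) : Type where
  s0 : Sf
  rules : Set (Sf × FAct M × Sf)
  rules_fin : rules.Finite

namespace FifoSys

variable {Sf M : Type}

inductive Step (F : FifoSys Sf M) : Sf × List M → Sf × List M → Prop
  | send {s s' : Sf} {m : M} {w : List M} :
      (s, FAct.send m, s') ∈ F.rules → Step F (s, w) (s', m :: w)
  | recv {s s' : Sf} {m : M} {w : List M} :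
      (s, FAct.recv m, s') ∈ F.rules → Step F (s, w ++ [m]) (s', w)
  | eps {s s' : Sf} {w : List M} :
      (s, FAct.eps, s') ∈ F.rules → Step F (s, w) (s', w)

/-- A control state is reachable iff some configuration with this control state is. -/
def ReachState (F : FifoSys Sf M) (c : Sf) : Prop :=
  ∃ w : List M, Relation.ReflTransGen F.Step (F.s0, []) (c, w)

end FifoSys

/-! ### Serial queues as lists of call vertices -/

namespace CTG

variable {Γ S : Type}

/-- The call vertices of `G`, from the most recently enqueued one to the head, are listed by `vs`,
all of them belong to the only queue, and this queue is handled serially. -/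
structure IsSerialQueue (G : CTG Unit Γ S) (vs : List ℕ) : Prop where
  nodup : vs.Nodup
  mem_iff : ∀ v, v ∈ vs ↔ v ∈ G.verts ∧ ¬ G.task v
  queueOf_eq : ∀ v ∈ vs, G.queueOf v = some ()
  qEdge_iff : ∀ a b, G.qEdge a b ↔ [a, b] <:+: vs
  wEdge_source : ∀ a b, G.wEdge a b → a ∈ vs
  wEdge_target : ∀ a b, G.wEdge a b → b ∈ G.verts ∧ G.task b
  wEdge_head : ∀ b ∈ G.verts, G.task b → G.queueOf b = some () →
    ∀ l a, vs = l ++ [a] → G.wEdge a b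
  task_unique : ∀ a ∈ G.verts, ∀ b ∈ G.verts, G.task a → G.task b →
    G.queueOf a = some () → G.queueOf b = some () → a = b

namespace IsSerialQueue

variable {G : CTG Unit Γ S} {vs : List ℕ}

theorem qEdge_mem (h : G.IsSerialQueue vs) {a b : ℕ} (hab : G.qEdge a b) : a ∈ vs ∧ b ∈ vs := by
  have hsub := ((h.qEdge_iff a b).1 hab).subset
  exact ⟨hsub (by simp), hsub (by simp)⟩

theorem unblocked_of_task (h : G.IsSerialQueue vs) {v : ℕ} (hv : v ∈ G.verts) (ht : G.task v) :
    G.Unblocked v := by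
  refine ⟨hv, fun b hb => ?_⟩
  have hmem : v ∈ vs := hb.elim (fun hq => (h.qEdge_mem hq).1) (h.wEdge_source v b)
  exact ((h.mem_iff v).1 hmem).2 ht

theorem setSt (h : G.IsSerialQueue vs) (v : ℕ) (s : S) : (G.setSt v s).IsSerialQueue vs :=
  ⟨h.nodup, h.mem_iff, h.queueOf_eq, h.qEdge_iff, h.wEdge_source, h.wEdge_target, h.wEdge_head,
    h.task_unique⟩

theorem isTail_iff (h : G.IsSerialQueue vs) (b : ℕ) : G.IsTail () b ↔ ∃ r, vs = b :: r := by
  constructor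
  · rintro ⟨hb, ht, -, hq⟩
    obtain ⟨l, r, hlr⟩ := List.append_of_mem ((h.mem_iff b).2 ⟨hb, ht⟩)
    rcases List.eq_nil_or_concat l with rfl | ⟨l', a, rfl⟩
    · exact ⟨r, by simpa using hlr⟩
    · exact (hq a ((h.qEdge_iff a b).2 ⟨l', r, by simp [hlr]⟩)).elim
  · rintro ⟨r, rfl⟩
    have hb := (h.mem_iff b).1 (by simp)
    refine ⟨hb.1, hb.2, h.queueOf_eq b (by simp), fun a ha => ?_⟩
    obtain ⟨l, r', hlr⟩ := (h.qEdge_iff a b).1 ha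
    have hnd := h.nodup
    rcases l with _ | ⟨x, l⟩
    · simp only [List.nil_append, List.cons_append, List.cons.injEq] at hlr
      obtain ⟨rfl, rfl⟩ := hlr
      simp at hnd
    · simp only [List.cons_append, List.cons.injEq] at hlr
      obtain ⟨rfl, rfl⟩ := hlr
      simp at hnd

theorem eq_append_of_isHead (h : G.IsSerialQueue vs) {v : ℕ} (hv : G.IsHead () v) :
    ∃ l, vs = l ++ [v] := by
  obtain ⟨hb, ht, -, hq⟩ := hv
  obtain ⟨l, r, hlr⟩ := List.append_of_mem ((h.mem_iff v).2 ⟨hb, ht⟩)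
  rcases r with _ | ⟨a, r⟩
  · exact ⟨l, hlr⟩
  · exact (hq a ((h.qEdge_iff v a).2 ⟨l, r, by simp [hlr]⟩)).elim

theorem isHead_of_eq_append {l : List ℕ} {v : ℕ} (h : G.IsSerialQueue (l ++ [v])) :
    G.IsHead () v := by
  have hv := (h.mem_iff v).1 (by simp)
  refine ⟨hv.1, hv.2, h.queueOf_eq v (by simp), fun b hb => ?_⟩
  obtain ⟨l', r, hlr⟩ := (h.qEdge_iff v b).1 hb
  have hnd := h.nodup
  rcases List.eq_nil_or_concat r with rfl | ⟨r', a, rfl⟩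
  · have hlr' : (l' ++ [v]) ++ [b] = l ++ [v] := by simpa using hlr
    obtain ⟨rfl, hbv⟩ := List.append_inj' hlr' rfl
    simp only [List.cons.injEq, and_true] at hbv
    subst hbv
    simp [List.nodup_append] at hnd
  · have hlr' : (l' ++ v :: b :: r') ++ [a] = l ++ [v] := by simpa using hlr
    obtain ⟨rfl, hav⟩ := List.append_inj' hlr' rfl
    simp only [List.cons.injEq, and_true] at hav
    subst hav
    simp [List.nodup_append] at hnd

theorem enqueue (h : G.IsSerialQueue vs) {p : Prop} (hp : p) (γ : Γ) (s0 : S) {v' : ℕ}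
    (hv' : v' ∉ G.verts) : (G.enqueue p () γ s0 v').IsSerialQueue (v' :: vs) := by
  have hvs : v' ∉ vs := fun hm => hv' ((h.mem_iff v').1 hm).1
  have hne : ∀ {b}, b ∈ G.verts → b ≠ v' := fun hb e => hv' (e ▸ hb)
  refine ⟨List.nodup_cons.2 ⟨hvs, h.nodup⟩, fun v => ?_, fun v hv => ?_, fun a b => ?_,
    fun a b hab => ?_, fun a b hab => ?_, fun b hb ht hq l a hla => ?_,
    fun a ha b hb hta htb hqa hqb => ?_⟩
  · have := h.mem_iff v
    by_cases e : v = v' <;> simp [CTG.enqueue, e, this]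
  · by_cases e : v = v'
    · simp [CTG.enqueue, e]
    · simpa [CTG.enqueue, e] using h.queueOf_eq v (by simpa [e] using hv)
  · simp only [CTG.enqueue, h.qEdge_iff, h.isTail_iff, List.infix_cons_iff, List.cons_prefix_cons]
    constructor
    · rintro (hab | ⟨rfl, r, rfl⟩)
      · exact Or.inr hab
      · exact Or.inl ⟨rfl, by simp⟩
    · rintro (⟨rfl, r, hr⟩ | hab)
      · exact Or.inr ⟨rfl, r, by simpa using hr.symm⟩
      · exact Or.inl hab
  · rcases hab with hab | ⟨-, rfl, -⟩
    · exact List.mem_cons_of_mem _ (h.wEdge_source a b hab)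
    · simp
  · have hb : b ∈ G.verts ∧ G.task b := by
      rcases hab with hab | ⟨-, -, hb, ht, -⟩
      exacts [h.wEdge_target a b hab, ⟨hb, ht⟩]
    exact ⟨Finset.mem_insert_of_mem hb.1, hne hb.1, hb.2⟩
  · have hbv : b ≠ v' := ht.1
    have hbG : b ∈ G.verts := Finset.mem_of_mem_insert_of_ne hb hbv
    have hqG : G.queueOf b = some () := by simpa [CTG.enqueue, hbv] using hq
    rcases l with _ | ⟨x, l⟩
    · simp only [List.nil_append, List.cons.injEq] at hla
      exact Or.inr ⟨hp, hla.1.symm, hbG, ht.2, hqG⟩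
    · simp only [List.cons_append, List.cons.injEq] at hla
      exact Or.inl (h.wEdge_head b hbG ht.2 hqG l a hla.2)
  · exact h.task_unique a (Finset.mem_of_mem_insert_of_ne ha hta.1)
      b (Finset.mem_of_mem_insert_of_ne hb htb.1) hta.2 htb.2
      (by simpa [CTG.enqueue, hta.1] using hqa) (by simpa [CTG.enqueue, htb.1] using hqb)

theorem erase (h : G.IsSerialQueue vs) {v : ℕ} (ht : G.task v) :
    (G.erase v).IsSerialQueue vs := by
  have hne : ∀ {a}, a ∈ vs → a ≠ v := fun ha e => ((h.mem_iff _).1 ha).2 (e ▸ ht)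
  refine ⟨h.nodup, fun u => ?_, h.queueOf_eq, fun a b => ?_, fun a b hab => ?_,
    fun a b hab => ?_, fun b hb htb hq l a hla => ?_, fun a ha b hb => ?_⟩
  · simp only [CTG.erase, Finset.mem_erase, h.mem_iff]
    exact ⟨fun hu => ⟨⟨fun e => hu.2 (e ▸ ht), hu.1⟩, hu.2⟩, fun hu => ⟨hu.1.2, hu.2⟩⟩
  · rw [← h.qEdge_iff]
    exact ⟨fun hab => hab.1, fun hab =>
      ⟨hab, hne (h.qEdge_mem hab).1, hne (h.qEdge_mem hab).2⟩⟩
  · exact h.wEdge_source a b hab.1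
  · have := h.wEdge_target a b hab.1
    exact ⟨Finset.mem_erase.2 ⟨hab.2.2, this.1⟩, this.2⟩
  · obtain ⟨hbv, hb⟩ := Finset.mem_erase.1 hb
    exact ⟨h.wEdge_head b hb htb hq l a hla, hne (by simp [hla]), hbv⟩
  · exact h.task_unique a (Finset.mem_erase.1 ha).2 b (Finset.mem_erase.1 hb).2

theorem dequeue {l : List ℕ} {v : ℕ} (h : G.IsSerialQueue (l ++ [v])) {p : Prop} (hp : p)
    (hout : ∀ b, ¬ G.edge v b) : (G.dequeue p v).IsSerialQueue l := by
  have hnd := List.nodup_append.1 h.nodup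
  have hvl : v ∉ l := fun hv => hnd.2.2 v hv v (by simp) rfl
  have hv := (h.mem_iff v).1 (by simp)
  have hno : ∀ b ∈ G.verts, G.task b → G.queueOf b ≠ some () := fun b hb ht hq =>
    hout b (Or.inr (h.wEdge_head b hb ht hq l v rfl))
  have hlast : ∀ l' a, l = l' ++ [a] → G.qEdge a v := fun l' a e =>
    (h.qEdge_iff a v).2 ⟨l', [], by simp [e]⟩
  have hsrc : ∀ {a}, a ∈ l ++ [v] → a ≠ v → a ∈ l := fun ha hav => by simpa [hav] using ha
  refine ⟨hnd.1, fun u => ?_, fun u hu => h.queueOf_eq u (by simp [hu]), fun a b => ?_,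
    fun a b hab => ?_, fun a b hab => ?_, fun b hb ht hq l' a hla => ?_,
    fun a ha b hb hta htb hqa hqb => ?_⟩
  · have := h.mem_iff u
    by_cases e : u = v
    · simp [CTG.dequeue, e, hvl]
    · simpa [CTG.dequeue, e] using this
  · simp only [CTG.dequeue, h.qEdge_iff]
    constructor
    · rintro ⟨⟨l', r, hlr⟩, ha, hb⟩
      rcases List.eq_nil_or_concat r with rfl | ⟨r', x, rfl⟩
      · have hlr' : (l' ++ [a]) ++ [b] = l ++ [v] := by simpa using hlr
        exact (hb (by simpa using (List.append_inj' hlr' rfl).2)).elim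
      · have hlr' : (l' ++ [a, b] ++ r') ++ [x] = l ++ [v] := by simpa using hlr
        exact ⟨l', r', (List.append_inj' hlr' rfl).1⟩
    · intro hab
      refine ⟨hab.trans ⟨[], [v], by simp⟩, fun e => hvl (e ▸ hab.subset (by simp)),
        fun e => hvl (e ▸ hab.subset (by simp))⟩
  · rcases hab with hab | ⟨-, rfl, hab⟩
    · exact hsrc (h.wEdge_source a b hab) fun e => hout b (Or.inr (e ▸ hab))
    · exact hsrc (h.qEdge_mem hab).1 fun e => hout b (Or.inl (e ▸ hab))
  · rcases hab with hab | ⟨-, rfl, hab⟩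
    · exact ⟨(h.wEdge_target a b hab).1, Or.inr (h.wEdge_target a b hab).2⟩
    · exact ⟨hv.1, Or.inl rfl⟩
  · rcases ht with rfl | ht
    · exact Or.inr ⟨hp, rfl, hlast l' a hla⟩
    · exact (hno b hb ht hq).elim
  · rcases hta with rfl | hta
    · rcases htb with rfl | htb
      · rfl
      · exact (hno b hb htb hqb).elim
    · exact (hno a ha hta hqa).elim

end IsSerialQueue

end CTG

/-! ### The serial QDAS simulating a fifo system -/

namespace FifoSys

/-- What a vertex of the simulating QDAS does: it simulates the fifo system, currently in the
control state `s`; it waits to be received; or it has handed over the simulation. -/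
inductive Phase (Sf : Type) : Type
  | run (s : Sf)
  | idle
  | halted

instance {Sf : Type} [Finite Sf] : Finite (Phase Sf) :=
  Finite.of_surjective (fun o : Option (Option Sf) =>
    match o with
    | none => Phase.halted
    | some none => Phase.idle
    | some (some s) => Phase.run s) fun p => by
      cases p with
      | run s => exact ⟨some (some s), rfl⟩
      | idle => exact ⟨some none, rfl⟩
      | halted => exact ⟨none, rfl⟩

variable {Sf M : Type}

/-- The rule by which block `γ` simulates a fifo transition. A reception of `m` is simulated by
block `some m`, which takes over the control state stored in the variable. -/
def simRule (γ : Option M) : Sf × FAct M × Sf →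
    (Option M × Phase Sf) × QAct Unit (Option M) Unit (Option Sf) × (Option M × Phase Sf)
  | (s, .send m, s') => ((γ, .run s), .dispatchA () (some m), (γ, .run s'))
  | (s, .eps, s') => ((γ, .run s), .guard [], (γ, .run s'))
  | (s, .recv m, s') => ((some m, .idle), .guard [((), some s, true)], (some m, .run s'))

/-- The rule by which block `γ` stores the current control state and stops. -/
def handRule (p : Option M × Sf) :
    (Option M × Phase Sf) × QAct Unit (Option M) Unit (Option Sf) × (Option M × Phase Sf) :=
  ((p.1, .run p.2), .assign () (some p.2), (p.1, .halted))

/-- The asynchronous QDAS with one serial queue simulating `F`: the channel is the queue, with one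
block per message, and the control state is handed over through a single variable. -/
def toQDAS [Finite Sf] [Finite M] (F : FifoSys Sf M) :
    QDAS Unit (Option M) Unit (Option Sf) (Option M × Phase Sf) where
  serial := fun _ => True
  main := none
  d0 := none
  blockOf := Prod.fst
  init := fun γ => (γ, γ.elim (.run F.s0) fun _ => .idle)
  final := fun γ => (γ, .halted)
  init_block := fun _ => rfl
  final_block := fun _ => rfl
  rules := Set.image2 simRule Set.univ F.rules ∪ Set.range handRule
  rules_fin := (Set.finite_univ.image2 _ F.rules_fin).union (Set.finite_range _)
  rules_block := by
    rintro r (⟨γ, -, ⟨s, a, s'⟩, -, rfl⟩ | ⟨p, rfl⟩)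
    · cases a <;> rfl
    · rfl
  rules_not_main := by
    rintro r (⟨γ, -, ⟨s, a, s'⟩, -, rfl⟩ | ⟨p, rfl⟩) q γ' h
    · cases a <;> simp [simRule] at h
      simp [← h]
    · simp [handRule] at h

variable [Finite Sf] [Finite M] (F : FifoSys Sf M)

theorem toQDAS_asynchronous : F.toQDAS.Asynchronous := by
  rintro r (⟨γ, -, ⟨s, a, s'⟩, -, rfl⟩ | ⟨p, rfl⟩) q γ'
  · cases a <;> simp [simRule]
  · simp [handRule]

variable {F}

theorem dispatchA_mem_rules {x y : Option M × Phase Sf} {q : Unit} {γ : Option M} :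
    (x, QAct.dispatchA q γ, y) ∈ F.toQDAS.rules ↔
      ∃ s m s', (s, FAct.send m, s') ∈ F.rules ∧ γ = some m ∧ x.2 = .run s ∧
        y = (x.1, .run s') := by
  constructor
  · rintro (⟨γ, -, ⟨s, a, s'⟩, hr, h⟩ | ⟨p, h⟩)
    · cases a <;> simp [simRule, Prod.ext_iff] at h
      obtain ⟨⟨h1, h2⟩, h3, h4, h5⟩ := h
      exact ⟨s, _, s', hr, h3.symm, h2.symm, Prod.ext (h4.symm.trans h1) h5.symm⟩
    · simp [handRule] at h
  · rintro ⟨s, m, s', hr, rfl, hx, rfl⟩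
    exact Or.inl ⟨x.1, trivial, _, hr, by simp [simRule, ← hx]⟩

theorem guard_mem_rules {x y : Option M × Phase Sf} {g : List (Unit × Option Sf × Bool)} :
    (x, QAct.guard g, y) ∈ F.toQDAS.rules ↔
      (∃ s s', (s, FAct.eps, s') ∈ F.rules ∧ g = [] ∧ x.2 = .run s ∧ y = (x.1, .run s')) ∨
      (∃ s m s', (s, FAct.recv m, s') ∈ F.rules ∧ g = [((), some s, true)] ∧
        x = (some m, .idle) ∧ y = (some m, .run s')) := by
  constructor
  · rintro (⟨γ, -, ⟨s, a, s'⟩, hr, h⟩ | ⟨p, h⟩)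
    · cases a with
      | send m => simp [simRule] at h
      | recv m =>
        simp only [simRule, Prod.mk.injEq, QAct.guard.injEq] at h
        exact Or.inr ⟨s, m, s', hr, h.2.1.symm, h.1.symm, h.2.2.symm⟩
      | eps =>
        simp only [simRule, Prod.mk.injEq, QAct.guard.injEq] at h
        obtain ⟨rfl, rfl, rfl⟩ := h
        exact Or.inl ⟨s, s', hr, rfl, rfl, rfl⟩
    · simp [handRule] at h
  · rintro (⟨s, s', hr, rfl, hx, rfl⟩ | ⟨s, m, s', hr, rfl, rfl, rfl⟩)
    · exact Or.inl ⟨x.1, trivial, _, hr, by simp [simRule, ← hx]⟩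
    · exact Or.inl ⟨none, trivial, _, hr, rfl⟩

theorem assign_mem_rules {x y : Option M × Phase Sf} {i : Unit} {e : Option Sf} :
    (x, QAct.assign i e, y) ∈ F.toQDAS.rules ↔
      ∃ s, e = some s ∧ x.2 = .run s ∧ y = (x.1, .halted) := by
  constructor
  · rintro (⟨γ, -, ⟨s, a, s'⟩, hr, h⟩ | ⟨p, h⟩)
    · cases a <;> simp [simRule] at h
    · simp only [handRule, Prod.mk.injEq, QAct.assign.injEq] at h
      obtain ⟨rfl, ⟨-, rfl⟩, rfl⟩ := h
      exact ⟨p.2, rfl, rfl, rfl⟩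
  · rintro ⟨s, rfl, hx, rfl⟩
    exact Or.inr ⟨(x.1, s), by simp [handRule, ← hx]⟩

/-- The invariant of the simulating QDAS: the calls `vs`, together with the task that has been
dequeued but not yet received (if any), spell the channel content `w`; and the control state `s` is
either carried by the only simulating task or stored in the variable. -/
structure SimInv {Sf M : Type} (G : CTG Unit (Option M) (Option M × Phase Sf))
    (d : Unit → Option Sf) (vs us : List ℕ) (s : Sf) (w : List M) : Prop where
  queue : G.IsSerialQueue vs
  pending : us = vs ∨ ∃ u, G.task u ∧ us = vs ++ [u]
  mem_iff : ∀ u, u ∈ us ↔ u ∈ G.verts ∧ (G.st u).2 = .idle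
  word : us.map (fun u => (G.st u).1) = w.map some
  queueOf_idle : ∀ u ∈ us, G.queueOf u = some ()
  control : (∃ v ∈ G.verts, G.task v ∧ (G.st v).2 = .run s ∧
      (d () = none ∨ G.queueOf v = some ()) ∧
      ∀ u ∈ G.verts, ∀ s', (G.st u).2 = .run s' → u = v) ∨
    (d () = some s ∧ ∀ u ∈ G.verts, ∀ s', (G.st u).2 ≠ .run s')

theorem simInv_initConfig : SimInv F.toQDAS.initCTG (fun _ => none) [] [] F.s0 [] where
  queue := by
    constructor <;> simp [QDAS.initCTG]
  pending := Or.inl rfl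
  mem_iff := by simp [QDAS.initCTG, toQDAS]
  word := rfl
  queueOf_idle := by simp
  control := Or.inl ⟨0, by simp [QDAS.initCTG, toQDAS]⟩

namespace SimInv

variable {Sf M : Type} {G : CTG Unit (Option M) (Option M × Phase Sf)} {d : Unit → Option Sf}
  {vs us : List ℕ} {s : Sf} {w : List M}

theorem eq_of_run (h : SimInv G d vs us s w) {v : ℕ} (hv : v ∈ G.verts) {s' : Sf}
    (hs : (G.st v).2 = .run s') :
    s' = s ∧ (d () = none ∨ G.queueOf v = some ()) ∧
      ∀ u ∈ G.verts, ∀ s', (G.st u).2 = .run s' → u = v := by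
  rcases h.control with ⟨v', hv', -, hs', hd, hu⟩ | ⟨-, hu⟩
  · obtain rfl := hu v hv s' hs
    rw [hs] at hs'
    exact ⟨Phase.run.inj hs', hd, hu⟩
  · exact (hu v hv s' hs).elim

/-- The simulating task remains the only one when it changes its control state. -/
theorem setSt_run (h : SimInv G d vs us s w) {v : ℕ} (hv : v ∈ G.verts) (ht : G.task v)
    {s₁ : Sf} (hs : (G.st v).2 = .run s₁) (s' : Sf) :
    SimInv (G.setSt v ((G.st v).1, .run s')) d vs us s' w := by
  obtain ⟨-, hd, hu⟩ := h.eq_of_run hv hs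
  refine ⟨h.queue.setSt _ _, h.pending, fun u => ?_, ?_, h.queueOf_idle, Or.inl
    ⟨v, hv, ht, by simp [CTG.setSt], hd, fun u hu' t hst => ?_⟩⟩
  · rw [h.mem_iff]
    by_cases e : u = v <;> simp [CTG.setSt, e, hs]
  · rw [← h.word]
    refine List.map_congr_left fun u _ => ?_
    by_cases e : u = v <;> simp [CTG.setSt, e]
  · by_cases e : u = v
    · exact e
    · exact hu u hu' t (by simpa [CTG.setSt, e] using hst)

/-- The simulating task stores its control state and stops. -/
theorem setSt_halted (h : SimInv G d vs us s w) {v : ℕ} (hv : v ∈ G.verts)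
    {s₁ : Sf} (hs : (G.st v).2 = .run s₁) {d' : Unit → Option Sf} (hd' : d' () = some s₁) :
    SimInv (G.setSt v ((G.st v).1, .halted)) d' vs us s w := by
  obtain ⟨rfl, -, hu⟩ := h.eq_of_run hv hs
  refine ⟨h.queue.setSt _ _, h.pending, fun u => ?_, ?_, h.queueOf_idle, Or.inr
    ⟨hd', fun u hu' t hst => ?_⟩⟩
  · rw [h.mem_iff]
    by_cases e : u = v <;> simp [CTG.setSt, e, hs]
  · rw [← h.word]
    refine List.map_congr_left fun u _ => ?_
    by_cases e : u = v <;> simp [CTG.setSt, e]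
  · by_cases e : u = v
    · simp [CTG.setSt, e] at hst
    · exact e (hu u hu' t (by simpa [CTG.setSt, e] using hst))

theorem enqueue (h : SimInv G d vs us s w) {p : Prop} (hp : p) (γ : Option M) (m : M) {v' : ℕ}
    (hv' : v' ∉ G.verts) :
    SimInv (G.enqueue p () γ (some m, .idle) v') d (v' :: vs) (v' :: us) s (m :: w) := by
  have hne : ∀ {b}, b ∈ G.verts → b ≠ v' := fun hb e => hv' (e ▸ hb)
  have hus : ∀ {u}, u ∈ us → u ≠ v' := fun hu => hne ((h.mem_iff _).1 hu).1
  refine ⟨h.queue.enqueue hp _ _ hv', ?_, fun u => ?_, ?_, fun u hu => ?_, ?_⟩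
  · rcases h.pending with rfl | ⟨u, hu, rfl⟩
    · exact Or.inl rfl
    · exact Or.inr ⟨u, ⟨hus (by simp), hu⟩, rfl⟩
  · have := h.mem_iff u
    by_cases e : u = v' <;> simp [CTG.enqueue, e, this]
  · rw [List.map_cons, List.map_cons, ← h.word]
    congr 1
    · simp [CTG.enqueue]
    · exact List.map_congr_left fun u hu => by simp [CTG.enqueue, hus hu]
  · by_cases e : u = v'
    · simp [CTG.enqueue, e]
    · simpa [CTG.enqueue, e] using h.queueOf_idle u (by simpa [e] using hu)
  · rcases h.control with ⟨v, hv, ht, hs, hd, hu⟩ | ⟨hd, hu⟩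
    · have hvv := hne hv
      refine Or.inl ⟨v, Finset.mem_insert_of_mem hv, ⟨hvv, ht⟩, by simpa [CTG.enqueue, hvv] using hs,
        by simpa [CTG.enqueue, hvv] using hd, fun u hu' t hst => ?_⟩
      by_cases e : u = v'
      · simp [CTG.enqueue, e] at hst
      · exact hu u (Finset.mem_of_mem_insert_of_ne hu' e) t (by simpa [CTG.enqueue, e] using hst)
    · refine Or.inr ⟨hd, fun u hu' t hst => ?_⟩
      by_cases e : u = v'
      · simp [CTG.enqueue, e] at hst
      · exact hu u (Finset.mem_of_mem_insert_of_ne hu' e) t (by simpa [CTG.enqueue, e] using hst)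

theorem erase (h : SimInv G d vs us s w) {v : ℕ} (ht : G.task v) (hs : (G.st v).2 = .halted) :
    SimInv (G.erase v) d vs us s w := by
  refine ⟨h.queue.erase ht, h.pending, fun u => ?_, h.word, h.queueOf_idle, ?_⟩
  · rw [h.mem_iff]
    by_cases e : u = v <;> simp [CTG.erase, e, hs]
  · rcases h.control with ⟨v', hv', ht', hs', hd, hu⟩ | ⟨hd, hu⟩
    · refine Or.inl ⟨v', Finset.mem_erase.2 ⟨?_, hv'⟩, ht', hs', hd, fun u hu' =>
        hu u (Finset.mem_erase.1 hu').2⟩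
      rintro rfl
      simp [hs] at hs'
    · exact Or.inr ⟨hd, fun u hu' => hu u (Finset.mem_erase.1 hu').2⟩

theorem dequeue (h : SimInv G d vs us s w) {p : Prop} (hp : p) {v : ℕ} (hv : G.IsHead () v)
    (hout : ∀ b, ¬ G.edge v b) : ∃ l, SimInv (G.dequeue p v) d l us s w := by
  obtain ⟨l, rfl⟩ := h.queue.eq_append_of_isHead hv
  have hus : us = l ++ [v] := by
    rcases h.pending with e | ⟨u, hu, e⟩
    · exact e
    · have hmem : u ∈ us := by simp [e]
      exact (hout u (Or.inr (h.queue.wEdge_head u ((h.mem_iff u).1 hmem).1 hu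
        (h.queueOf_idle u hmem) l v rfl))).elim
  refine ⟨l, h.queue.dequeue hp hout, Or.inr ⟨v, Or.inl rfl, hus⟩, h.mem_iff, h.word,
    h.queueOf_idle, ?_⟩
  rcases h.control with ⟨v', hv', ht', hs'⟩ | hd
  · exact Or.inl ⟨v', hv', Or.inr ht', hs'⟩
  · exact Or.inr hd

/-- A task waiting to be received holds the message at the read end of the channel, and takes over
the control state stored in the variable. -/
theorem setSt_recv (h : SimInv G d vs us s w) {v : ℕ} (hv : v ∈ G.verts) (ht : G.task v) {m : M}
    (hs : G.st v = (some m, .idle)) {s₁ : Sf} (hd : d () = some s₁) (s' : Sf) :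
    s₁ = s ∧ ∃ w', w = w' ++ [m] ∧ SimInv (G.setSt v (some m, .run s')) d vs vs s' w' := by
  have hmem : v ∈ us := (h.mem_iff v).2 ⟨hv, by rw [hs]⟩
  have hvs : v ∉ vs := fun hm => ((h.queue.mem_iff v).1 hm).2 ht
  have hq := h.queueOf_idle v hmem
  have hus : us = vs ++ [v] := by
    rcases h.pending with rfl | ⟨u, -, rfl⟩
    · exact (hvs hmem).elim
    · simp only [List.mem_append, hvs, List.mem_singleton, false_or] at hmem
      rw [hmem]
  subst hus
  have hctl : d () = some s ∧ ∀ u ∈ G.verts, ∀ s', (G.st u).2 ≠ .run s' := by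
    rcases h.control with ⟨v', hv', ht', hs', hd' | hq', -⟩ | hc
    · simp [hd] at hd'
    · obtain rfl := h.queue.task_unique v hv v' hv' ht ht' hq hq'
      simp [hs] at hs'
    · exact hc
  have hword := h.word
  rw [List.map_append, eq_comm, List.map_eq_append_iff] at hword
  obtain ⟨w', r, rfl, hw', hr⟩ := hword
  obtain rfl : r = [m] := by
    apply List.map_injective_iff.2 (Option.some_injective M)
    simpa [hs] using hr
  refine ⟨Option.some_injective _ (hd.symm.trans hctl.1), w', rfl, h.queue.setSt _ _, Or.inl rfl,
    fun u => ?_, ?_, fun u hu => h.queueOf_idle u (by simp [hu]), Or.inl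
    ⟨v, hv, ht, by simp [CTG.setSt], Or.inr hq, fun u hu t hst => ?_⟩⟩
  · by_cases e : u = v
    · simp [CTG.setSt, e, hvs]
    · have := h.mem_iff u
      simpa [CTG.setSt, e] using this
  · rw [hw']
    refine List.map_congr_left fun u hu => ?_
    have e : u ≠ v := fun e => hvs (e ▸ hu)
    simp [CTG.setSt, e]
  · by_cases e : u = v
    · exact e
    · exact (hctl.2 u hu t (by simpa [CTG.setSt, e] using hst)).elim

end SimInv

/-- Every configuration reachable in the simulating QDAS represents a reachable configuration of
the fifo system. -/
theorem exists_simInv_of_reach {c : QConfig Unit (Option M) Unit (Option Sf) (Option M × Phase Sf)}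
    (hc : c ∈ F.toQDAS.Reach) :
    ∃ vs us s w, SimInv c.1 c.2 vs us s w ∧
      Relation.ReflTransGen F.Step (F.s0, []) (s, w) := by
  induction hc with
  | refl => exact ⟨_, _, _, _, simInv_initConfig, .refl⟩
  | tail _ hstep ih =>
    obtain ⟨vs, us, s, w, h, hr⟩ := ih
    obtain ⟨a, hstep⟩ := hstep
    cases hstep with
    | guard ht hv hrule hsat =>
      rcases guard_mem_rules.1 hrule with
        ⟨s₁, s', hF, rfl, hst, rfl⟩ | ⟨s₁, m, s', hF, rfl, hst, rfl⟩
      · obtain rfl := (h.eq_of_run hv.1 hst).1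
        exact ⟨_, _, _, _, h.setSt_run hv.1 ht hst s', hr.tail (.eps hF)⟩
      · obtain ⟨rfl, w', rfl, h'⟩ := h.setSt_recv hv.1 ht hst (by simpa [GuardSat] using hsat) s'
        exact ⟨_, _, _, _, h', hr.tail (.recv hF)⟩
    | assign ht hv hrule =>
      obtain ⟨s₁, rfl, hst, rfl⟩ := assign_mem_rules.1 hrule
      exact ⟨_, _, _, _, h.setSt_halted hv.1 hst (by simp), hr⟩
    | dispatchA ht hv hrule hv' =>
      obtain ⟨s₁, m, s', hF, rfl, hst, rfl⟩ := dispatchA_mem_rules.1 hrule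
      obtain rfl := (h.eq_of_run hv.1 hst).1
      exact ⟨_, _, _, _, (h.setSt_run hv.1 ht hst s').enqueue trivial (some m) m hv',
        hr.tail (.send hF)⟩
    | dispatchS ht hv hrule hv' => exact (F.toQDAS_asynchronous _ hrule _ _ rfl).elim
    | schedErase ht hv hst => exact ⟨_, _, _, _, h.erase ht (by rw [hst]; rfl), hr⟩
    | schedDequeue hhead hout =>
      obtain ⟨l, h'⟩ := h.dequeue trivial hhead hout
      exact ⟨_, _, _, _, h', hr⟩

/-- The configurations of the simulating QDAS in which `v` is the only task and simulates the fifo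
system in control state `s`, and the queue spells the channel content `w`. -/
structure SimReady {Sf M : Type} (G : CTG Unit (Option M) (Option M × Phase Sf)) (v : ℕ)
    (vs : List ℕ) (s : Sf) (w : List M) : Prop where
  queue : G.IsSerialQueue vs
  mem : v ∈ G.verts
  task : G.task v
  task_eq : ∀ u ∈ G.verts, G.task u → u = v
  st_eq : G.st v = (G.lab v, .run s)
  word : vs.map (fun u => (G.lab u, G.st u)) = w.map fun m => (some m, (some m, .idle))

theorem simReady_initConfig : SimReady F.toQDAS.initCTG 0 [] F.s0 [] where
  queue := simInv_initConfig.queue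
  mem := by simp [QDAS.initCTG]
  task := by simp [QDAS.initCTG]
  task_eq := by simp [QDAS.initCTG]
  st_eq := rfl
  word := rfl

namespace SimReady

section

variable {Sf M : Type} {G : CTG Unit (Option M) (Option M × Phase Sf)} {v : ℕ} {vs : List ℕ}
  {s : Sf} {w : List M}

theorem ne_of_mem (h : SimReady G v vs s w) {u : ℕ} (hu : u ∈ vs) : u ≠ v :=
  fun e => ((h.queue.mem_iff u).1 hu).2 (e ▸ h.task)

theorem setSt (h : SimReady G v vs s w) (s' : Sf) :
    SimReady (G.setSt v (G.lab v, .run s')) v vs s' w := by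
  refine ⟨h.queue.setSt _ _, h.mem, h.task, h.task_eq, by simp [CTG.setSt], ?_⟩
  rw [← h.word]
  exact List.map_congr_left fun u hu => by simp [CTG.setSt, h.ne_of_mem hu]

theorem enqueue (h : SimReady G v vs s w) {p : Prop} (hp : p) (m : M) {v' : ℕ}
    (hv' : v' ∉ G.verts) :
    SimReady (G.enqueue p () (some m) (some m, .idle) v') v (v' :: vs) s (m :: w) := by
  have hv : v ≠ v' := fun e => hv' (e ▸ h.mem)
  refine ⟨h.queue.enqueue hp _ _ hv', Finset.mem_insert_of_mem h.mem, ⟨hv, h.task⟩,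
    fun u hu ht => h.task_eq u (Finset.mem_of_mem_insert_of_ne hu ht.1) ht.2,
    by simpa [CTG.enqueue, hv] using h.st_eq, ?_⟩
  rw [List.map_cons, List.map_cons, ← h.word]
  congr 1
  · simp [CTG.enqueue]
  · refine List.map_congr_left fun u hu => ?_
    have hu' : u ≠ v' := fun e => hv' (e ▸ ((h.queue.mem_iff u).1 hu).1)
    simp [CTG.enqueue, hu']

end

variable {G : CTG Unit (Option M) (Option M × Phase Sf)} {d : Unit → Option Sf} {v : ℕ}
  {vs : List ℕ} {s s' : Sf} {w w' : List M}

theorem exists_recv {m : M} (h : SimReady G v vs s (w ++ [m])) (hF : (s, FAct.recv m, s') ∈ F.rules)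
    (hc : (G, d) ∈ F.toQDAS.Reach) :
    ∃ G' d' v' vs', (G', d') ∈ F.toQDAS.Reach ∧ SimReady G' v' vs' s' w := by
  have hword := h.word
  rw [List.map_append, List.map_eq_append_iff] at hword
  obtain ⟨l, r, rfl, hl, hr⟩ := hword
  obtain ⟨u, rfl⟩ : ∃ u, r = [u] := List.length_eq_one_iff.1 (by simpa using congrArg List.length hr)
  simp only [List.map_cons, List.map_nil, List.cons.injEq, Prod.mk.injEq, and_true] at hr
  have huv : u ≠ v := h.ne_of_mem (by simp)
  have hul : u ∉ l := fun hu => (List.nodup_append.1 h.queue.nodup).2.2 u hu u (by simp) rfl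
  set G₁ := G.setSt v ((G.st v).1, .halted) with hG₁
  have q₁ : G₁.IsSerialQueue (l ++ [u]) := h.queue.setSt _ _
  have q₂ : (G₁.erase v).IsSerialQueue (l ++ [u]) := q₁.erase h.task
  have hhead : (G₁.erase v).IsHead () u := q₂.isHead_of_eq_append
  have hout : ∀ b, ¬ (G₁.erase v).edge u b := by
    rintro b (hb | hb)
    · exact hhead.2.2.2 b hb
    · obtain ⟨hbv, hbt⟩ := q₂.wEdge_target u b hb
      exact (Finset.mem_erase.1 hbv).1 (h.task_eq b (Finset.mem_erase.1 hbv).2 hbt)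
  have q₃ : ((G₁.erase v).dequeue True u).IsSerialQueue l := q₂.dequeue trivial hout
  have hu₃ : u ∈ ((G₁.erase v).dequeue True u).verts := hhead.1
  have ht₃ : ((G₁.erase v).dequeue True u).task u := Or.inl rfl
  have hst₃ : ((G₁.erase v).dequeue True u).st u = (some m, .idle) := by
    simpa [hG₁, CTG.dequeue, CTG.erase, CTG.setSt, huv] using hr.2
  obtain ⟨d₁, hd₁, c₁⟩ :
      ∃ d₁ : Unit → Option Sf, d₁ () = some s ∧ (G₁, d₁) ∈ F.toQDAS.Reach := by
    refine ⟨_, ?_, hc.tail ⟨_, .assign (x := ()) h.task (h.queue.unblocked_of_task h.mem h.task)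
      (assign_mem_rules.2 ⟨s, rfl, by rw [h.st_eq], rfl⟩)⟩⟩
    simp
  have c₂ : (G₁.erase v, d₁) ∈ F.toQDAS.Reach :=
    c₁.tail ⟨_, .schedErase h.task (q₁.unblocked_of_task h.mem h.task)
      (by simp [hG₁, CTG.setSt, h.st_eq, toQDAS])⟩
  have c₃ : ((G₁.erase v).dequeue True u, d₁) ∈ F.toQDAS.Reach :=
    c₂.tail ⟨_, .schedDequeue hhead hout⟩
  refine ⟨_, _, u, l, c₃.tail ⟨_, .guard ht₃ (q₃.unblocked_of_task hu₃ ht₃)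
    (guard_mem_rules.2 (Or.inr ⟨s, m, s', hF, rfl, hst₃, rfl⟩)) (by simp [GuardSat, hd₁])⟩,
    q₃.setSt _ _, hu₃, ht₃, ?_, ?_, ?_⟩
  · rintro x hx (rfl | ht)
    · rfl
    · exact ((Finset.mem_erase.1 hx).1 (h.task_eq x (Finset.mem_erase.1 hx).2 ht)).elim
  · simp [hG₁, CTG.setSt, CTG.dequeue, CTG.erase, hr.1]
  · rw [← hl]
    refine List.map_congr_left fun x hx => ?_
    have hxu : x ≠ u := fun e => hul (e ▸ hx)
    have hxv : x ≠ v := h.ne_of_mem (by simp [hx])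
    simp [hG₁, CTG.setSt, CTG.dequeue, CTG.erase, hxu, hxv]

theorem exists_step (h : SimReady G v vs s w) (hF : F.Step (s, w) (s', w'))
    (hc : (G, d) ∈ F.toQDAS.Reach) :
    ∃ G' d' v' vs', (G', d') ∈ F.toQDAS.Reach ∧ SimReady G' v' vs' s' w' := by
  have hunbl := h.queue.unblocked_of_task h.mem h.task
  have hrun : (G.st v).2 = .run s := by rw [h.st_eq]
  have hlab : (G.st v).1 = G.lab v := by rw [h.st_eq]
  cases hF with
  | @send _ _ m _ hF =>
    obtain ⟨v', hv'⟩ := Infinite.exists_notMem_finset G.verts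
    exact ⟨_, d, v, v' :: vs, hc.tail ⟨_, .dispatchA h.task hunbl
      (dispatchA_mem_rules.2 ⟨s, m, s', hF, rfl, hrun, by rw [hlab]⟩) hv'⟩,
      (h.setSt s').enqueue trivial m hv'⟩
  | recv hF => exact h.exists_recv hF hc
  | eps hF =>
    exact ⟨_, d, v, vs, hc.tail ⟨_, .guard h.task hunbl
      (guard_mem_rules.2 (Or.inl ⟨s, s', hF, rfl, hrun, by rw [hlab]⟩)) (by simp [GuardSat])⟩,
      h.setSt s'⟩

end SimReady

/-- Every reachable configuration of the fifo system is represented by a reachable configuration of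
the simulating QDAS. -/
theorem exists_simReady_of_reach {c : Sf × List M}
    (hc : Relation.ReflTransGen F.Step (F.s0, []) c) :
    ∃ G d v vs, (G, d) ∈ F.toQDAS.Reach ∧ SimReady G v vs c.1 c.2 := by
  induction hc with
  | refl => exact ⟨_, _, _, _, .refl, simReady_initConfig⟩
  | tail _ hstep ih =>
    obtain ⟨G, d, v, vs, hG, h⟩ := ih
    exact h.exists_step hstep hG

end FifoSys

theorem QDAS.parikhCoverable_single_iff {Q Γ X D S : Type} (A : QDAS Q Γ X D S) (t : S) :
    A.ParikhCoverable (fun s => if s = t then 1 else 0) ↔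
      ∃ c ∈ A.Reach, ∃ v ∈ c.1.verts, c.1.st v = t := by
  refine exists_congr fun c => and_congr_right fun _ => ⟨fun h => ?_, ?_⟩
  · have ht : 0 < c.1.parikh t := by simpa [Nat.one_le_iff_ne_zero, Nat.pos_iff_ne_zero] using h t
    obtain ⟨v, hv⟩ := Finset.card_pos.1 ht
    exact ⟨v, Finset.mem_filter.1 hv⟩
  · rintro ⟨v, hv, rfl⟩ s
    by_cases e : s = c.1.st v
    · subst e
      simpa [CTG.parikh, Nat.one_le_iff_ne_zero] using ⟨v, hv, rfl⟩
    · simp [e]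

/-- For every fifo system `F` and control state `c` there is an
asynchronous QDAS `A_F` with exactly one queue, which is serial, and a family of
states `t m` of its blocks indexed by `m ∈ M ∪ {ε}` (here `Option M`, with `none`
playing ε), such that `c` is reachable in `F` iff for some `m ∈ M ∪ {ε}` the function
`f_m` (value `1` on `t m` and `0` elsewhere) is Parikh-coverable in `A_F`. -/
theorem fifo_reach_iff_serial_async_qdas_parikh
    {Sf M : Type} [Fintype Sf] [Fintype M] (F : FifoSys Sf M) (c : Sf) :
    ∃ (Γ X D S : Type) (_iΓ : Fintype Γ) (_iX : Fintype X) (_iD : Fintype D)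
      (_iS : Fintype S) (A : QDAS Unit Γ X D S) (t : Option M → S),
      A.Asynchronous ∧ (∀ q, A.serial q) ∧ Function.Injective t ∧
      (F.ReachState c ↔
        ∃ m : Option M, A.ParikhCoverable (fun s => if s = t m then 1 else 0)) := by
  refine ⟨Option M, Unit, Option Sf, Option M × FifoSys.Phase Sf, inferInstance, inferInstance,
    inferInstance, Fintype.ofFinite _, F.toQDAS, fun m => (m, .run c), F.toQDAS_asynchronous,
    fun _ => trivial, fun m m' h => congrArg Prod.fst h, ?_⟩
  simp only [QDAS.parikhCoverable_single_iff]
  constructor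
  · rintro ⟨w, hw⟩
    obtain ⟨G, d, v, vs, hG, h⟩ := FifoSys.exists_simReady_of_reach hw
    exact ⟨G.lab v, _, hG, v, h.mem, h.st_eq⟩
  · rintro ⟨m, C, hC, v, hv, hst⟩
    obtain ⟨vs, us, s, w, h, hr⟩ := FifoSys.exists_simInv_of_reach hC
    obtain rfl := (h.eq_of_run hv (by rw [hst])).1
    exact ⟨w, hr⟩
end
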